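/- arXiv:1909.04982 — 3 statements merged into one kernel-verified Lean document; each statement's English description precedes it below -/
import Mathlib

section
/- Let p be an odd prime and let a, b be integers, and set ε = a² + b² + 1. Consider the number N of triples (u, v, w) of vectors in ℤ³ satisfying u·u = ε, v·v = p², w·w = p², u·v = a·p, u·w = b·p, and v·w = 0 (where · denotes the standard dot product on ℤ³). Then N = 144 if the Legendre symbol (−ε / p) equals 1, N = 48 if (−ε / p) = −1, and N = 96 if p divides ε. -/
open Matrix Quaternion

section Field
variable {F : Type*} [Field F]

theorem exists_eq_smul_of_cross_eq_zero {n m : Fin 3 → F} (hn : n ≠ 0) (h : n ⨯₃ m = 0) :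
    ∃ r : F, m = r • n := by
  rw [cross_apply] at h
  have h0 := congrFun h 0
  have h1 := congrFun h 1
  have h2 := congrFun h 2
  simp at h0 h1 h2
  obtain ⟨i, hi⟩ := Function.ne_iff.mp hn
  refine ⟨m i / n i, ?_⟩
  ext j
  simp only [Pi.smul_apply, smul_eq_mul, Pi.zero_apply] at hi ⊢
  rw [div_mul_eq_mul_div, eq_div_iff hi]
  fin_cases i <;> fin_cases j <;> simp <;> grind

theorem exists_eq_smul_of_isotropic {n m : Fin 3 → F} (hn : n ≠ 0) (hnn : n ⬝ᵥ n = 0)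
    (hnm : n ⬝ᵥ m = 0) (hmm : m ⬝ᵥ m = 0) : ∃ r : F, m = r • n := by
  have h1 : n ⨯₃ (n ⨯₃ m) = 0 := by
    rw [cross_cross_eq_smul_sub_smul', hnm, hnn]; simp
  have h2 : m ⨯₃ (n ⨯₃ m) = 0 := by
    rw [cross_cross_eq_smul_sub_smul', dotProduct_comm, hnm, hmm]; simp
  obtain ⟨s, hs⟩ := exists_eq_smul_of_cross_eq_zero hn h1
  rw [hs, map_smul, ← cross_anticomm, hs, smul_neg, neg_eq_zero, smul_smul, smul_eq_zero] at h2
  have hs0 : s = 0 := by simpa [hn] using h2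
  exact exists_eq_smul_of_cross_eq_zero hn (by rw [hs, hs0, zero_smul])

theorem exists_sq_eq_of_isotropic_of_dot_eq_zero {c m : Fin 3 → F} (hm : m ≠ 0)
    (hmm : m ⬝ᵥ m = 0) (hcm : c ⬝ᵥ m = 0) :
    ∃ s : F, c ⨯₃ m = s • m ∧ s ^ 2 = -(c ⬝ᵥ c) := by
  obtain ⟨s, hs⟩ := exists_eq_smul_of_isotropic (m := c ⨯₃ m) hm hmm (dot_cross_self _ _)
    (by rw [cross_dot_cross, hmm, hcm]; simp)
  refine ⟨s, hs, ?_⟩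
  have h := cross_cross_eq_smul_sub_smul' c c m
  rw [hs, map_smul, hs, hcm, zero_smul, zero_sub, smul_smul, ← neg_smul] at h
  have := smul_left_injective F hm h
  rw [sq, this]

theorem exists_isotropic_eigenvector {c : Fin 3 → F} {d : F} (hd : d ≠ 0)
    (h : d ^ 2 = -(c ⬝ᵥ c)) :
    ∃ n : Fin 3 → F, n ≠ 0 ∧ n ⬝ᵥ n = 0 ∧ c ⬝ᵥ n = 0 ∧ c ⨯₃ n = d • n := by
  obtain ⟨n, hn, hk⟩ := (Matrix.exists_mulVec_eq_zero_iff
    (M := !![-d, -c 2, c 1; c 2, -d, -c 0; -c 1, c 0, -d])).mpr (by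
      simp [Matrix.det_fin_three, dotProduct, Fin.sum_univ_three] at h ⊢
      linear_combination (-d) * h)
  have he : c ⨯₃ n = d • n := by
    have h0 := congrFun hk 0
    have h1 := congrFun hk 1
    have h2 := congrFun hk 2
    simp [Matrix.mulVec, dotProduct, Fin.sum_univ_three] at h0 h1 h2
    rw [cross_apply]
    ext i
    fin_cases i <;> simp <;> grind
  refine ⟨n, hn, ?_, ?_, he⟩
  · have := dot_cross_self c n
    rw [he, dotProduct_smul, smul_eq_mul] at this
    exact (mul_eq_zero.mp this).resolve_left hd
  · have := dot_self_cross c n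
    rw [he, dotProduct_smul, smul_eq_mul] at this
    exact (mul_eq_zero.mp this).resolve_left hd

theorem dot_eq_zero_of_eigenvectors {c m n : Fin 3 → F} {d : F} (hd : 2 * d ≠ 0)
    (hm : c ⨯₃ m = d • m) (hn : c ⨯₃ n = d • n) : m ⬝ᵥ n = 0 := by
  have h : m ⬝ᵥ c ⨯₃ n + n ⬝ᵥ c ⨯₃ m = 0 := by
    simp [cross_apply, dotProduct, Fin.sum_univ_three]; ring
  rw [hm, hn, dotProduct_smul, dotProduct_smul, dotProduct_comm n m, smul_eq_mul] at h
  have h' : 2 * d * (m ⬝ᵥ n) = 0 := by linear_combination h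
  exact (mul_eq_zero.mp h').resolve_left hd

end Field

section Descent

/-- The integral quaternion with the given coordinates. -/
def quat (x y z w : ℤ) : ℍ[ℤ] := ⟨x, y, z, w⟩

@[simp] theorem re_quat (x y z w : ℤ) : (quat x y z w).re = x := rfl
@[simp] theorem imI_quat (x y z w : ℤ) : (quat x y z w).imI = y := rfl
@[simp] theorem imJ_quat (x y z w : ℤ) : (quat x y z w).imJ = z := rfl
@[simp] theorem imK_quat (x y z w : ℤ) : (quat x y z w).imK = w := rfl

theorem dvd_mul_of_coprime_mul {p m : ℤ} (hpm : IsCoprime m p) {q q' r n : ℍ[ℤ]}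
    (h : r * q = m * q') (hq : (p : ℍ[ℤ]) ∣ q * n) : (p : ℍ[ℤ]) ∣ q' * n := by
  obtain ⟨u, v, huv⟩ := hpm
  obtain ⟨c, hc⟩ := hq
  have hcomm : r * (p : ℍ[ℤ]) = p * r := (Int.cast_commute p r).symm.eq
  have hu : (u : ℍ[ℤ]) * p = p * u := (Int.cast_commute u _).eq
  have hv : (v : ℍ[ℤ]) * p = p * v := (Int.cast_commute v _).eq
  refine ⟨u * (r * c) + v * (q' * n), ?_⟩
  have h1 : (m : ℍ[ℤ]) * (q' * n) = p * (r * c) := by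
    rw [← mul_assoc, ← h, mul_assoc, hc, ← mul_assoc, hcomm, mul_assoc]
  have h2 : ((u * m + v * p : ℤ) : ℍ[ℤ]) = 1 := by rw [huv]; simp
  calc q' * n = ((u * m + v * p : ℤ) : ℍ[ℤ]) * (q' * n) := by rw [h2, one_mul]
    _ = u * (m * (q' * n)) + v * p * (q' * n) := by push_cast; noncomm_ring
    _ = _ := by rw [h1, hv, mul_add, ← mul_assoc, hu]; noncomm_ring

theorem normSq_half {r q q' : ℍ[ℤ]} (hr : normSq r = 2) (h : r * q = (2 : ℤ) * q') :
    normSq q = 2 * normSq q' := by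
  have h1 := congrArg normSq h
  rw [map_mul, map_mul, hr, normSq_intCast] at h1
  norm_num at h1
  linarith

theorem exists_half_of_even_normSq {q : ℍ[ℤ]} (h : Even (normSq q)) :
    ∃ r q' : ℍ[ℤ], normSq r = 2 ∧ r * q = (2 : ℤ) * q' := by
  rw [normSq_def'] at h
  simp only [Int.even_add, Int.even_pow] at h
  have key : (2 ∣ q.re - q.imI ∧ 2 ∣ q.imJ - q.imK) ∨
      (2 ∣ q.re - q.imJ ∧ 2 ∣ q.imK - q.imI) ∨ (2 ∣ q.re - q.imK ∧ 2 ∣ q.imI - q.imJ) := by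
    simp only [Int.even_iff] at h
    omega
  rcases key with ⟨⟨s, hs⟩, ⟨t, ht⟩⟩ | ⟨⟨s, hs⟩, ⟨t, ht⟩⟩ | ⟨⟨s, hs⟩, ⟨t, ht⟩⟩
  · refine ⟨quat 1 1 0 0, quat s (q.imI + s) t (q.imK + t), by simp [normSq_def'], ?_⟩
    ext <;> simp [-Int.cast_ofNat] <;> linarith
  · refine ⟨quat 1 0 1 0, quat s (q.imI + t) (q.imJ + s) t, by simp [normSq_def'], ?_⟩
    ext <;> simp [-Int.cast_ofNat] <;> linarith
  · refine ⟨quat 1 0 0 1, quat s t (q.imJ + t) (q.imK + s), by simp [normSq_def'], ?_⟩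
    ext <;> simp [-Int.cast_ofNat] <;> linarith

theorem exists_abs_lt_of_odd {k : ℕ} (hk : Odd k) (x : ℤ) :
    ∃ r t : ℤ, x = r + k * t ∧ 2 * |r| < k := by
  refine ⟨x.bmod k, (x - x.bmod k) / k, ?_, ?_⟩
  · have : (k : ℤ) ∣ x - x.bmod k := Int.dvd_self_sub_bmod
    rw [Int.mul_ediv_cancel' this]; ring
  · have h0 : 0 < k := hk.pos
    have h1 := Int.le_bmod (x := x) h0
    have h2 := Int.bmod_lt (x := x) h0
    obtain ⟨j, rfl⟩ := hk
    rw [← abs_two, ← abs_mul, abs_lt]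
    omega

theorem exists_normSq_lt_of_odd {k : ℕ} (hk : Odd k) (q : ℍ[ℤ]) :
    ∃ r t : ℍ[ℤ], q = r + (k : ℤ) * t ∧ normSq r < (k : ℤ) ^ 2 := by
  obtain ⟨r0, t0, h0, l0⟩ := exists_abs_lt_of_odd hk q.re
  obtain ⟨r1, t1, h1, l1⟩ := exists_abs_lt_of_odd hk q.imI
  obtain ⟨r2, t2, h2, l2⟩ := exists_abs_lt_of_odd hk q.imJ
  obtain ⟨r3, t3, h3, l3⟩ := exists_abs_lt_of_odd hk q.imK
  refine ⟨quat r0 r1 r2 r3, quat t0 t1 t2 t3, ?_, ?_⟩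
  · ext <;> simp [h0, h1, h2, h3]
  · have key : ∀ r : ℤ, 2 * |r| < k → 4 * r ^ 2 < (k : ℤ) ^ 2 := fun r hr => by
      nlinarith [abs_nonneg r, sq_abs r]
    rw [normSq_def']
    simp only [re_quat, imI_quat, imJ_quat, imK_quat]
    linarith [key _ l0, key _ l1, key _ l2, key _ l3]

theorem exists_normSq_eq_of_dvd_mul {p : ℕ} (hp : p.Prime) (n : ℍ[ℤ]) (k : ℕ) (h0 : 0 < k)
    (hkp : k < p) (q : ℍ[ℤ]) (hq : normSq q = k * p) (hqn : ((p : ℤ) : ℍ[ℤ]) ∣ q * n) :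
    ∃ α : ℍ[ℤ], normSq α = p ∧ ((p : ℤ) : ℍ[ℤ]) ∣ α * n := by
  induction k using Nat.strong_induction_on generalizing q with
  | _ k ih =>
  have hp0 : (0 : ℤ) < p := mod_cast hp.pos
  have hcop : ∀ m : ℕ, 0 < m → m < p → IsCoprime (m : ℤ) (p : ℤ) := fun m hm hmp =>
    Nat.isCoprime_iff_coprime.mpr (Nat.coprime_of_lt_prime hm.ne' hmp hp).symm
  rcases Nat.even_or_odd k with hk | hk
  · obtain ⟨j, rfl⟩ := hk
    obtain ⟨r, q', hr, h⟩ := exists_half_of_even_normSq (q := q)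
      (by rw [hq]; push_cast; exact ⟨j * p, by ring⟩)
    have h2 := normSq_half hr h
    refine ih j (by omega) (by omega) (by omega) q' ?_
      (dvd_mul_of_coprime_mul (hcop 2 (by omega) (by omega)) h hqn)
    rw [hq] at h2
    push_cast at h2
    linarith
  · by_cases hk1 : k = 1
    · subst hk1
      exact ⟨q, by simpa using hq, hqn⟩
    obtain ⟨r, t, h, hlt⟩ := exists_normSq_lt_of_odd hk q
    have hk0 : (0 : ℤ) < k := mod_cast h0
    have hdvd : (k : ℤ) ∣ normSq r := by
      have e : normSq r = normSq q - k *
        (2 * (r.re * t.re + r.imI * t.imI + r.imJ * t.imJ + r.imK * t.imK) + k * normSq t) := by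
        rw [h]; simp [normSq_def']; ring
      rw [e, hq]
      exact dvd_sub (dvd_mul_right _ _) (dvd_mul_right _ _)
    obtain ⟨j, hj⟩ := hdvd
    have hstep : star r * q = ((k : ℤ) : ℍ[ℤ]) * ((j : ℤ) + star r * t) := by
      have hc : star r * ((k : ℤ) : ℍ[ℤ]) = (k : ℤ) * star r := (Int.cast_commute _ _).symm.eq
      rw [h, mul_add, star_mul_self, hj, ← mul_assoc, hc, mul_add, mul_assoc]
      push_cast; rfl
    have hnorm := congrArg normSq hstep
    rw [map_mul, normSq_star, map_mul, normSq_intCast, hj, hq] at hnorm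
    have hnorm' : normSq ((j : ℍ[ℤ]) + star r * t) = j * p := by
      have : (k : ℤ) ^ 2 ≠ 0 := by positivity
      apply mul_left_cancel₀ this
      linear_combination -hnorm
    have hj0 : 0 ≤ j := by
      have := normSq_nonneg (a := r)
      rw [hj] at this
      exact nonneg_of_mul_nonneg_right this hk0
    have hjk : j < k := by
      rw [hj, sq] at hlt
      exact lt_of_mul_lt_mul_left hlt hk0.le
    have hj1 : j ≠ 0 := by
      rintro rfl
      have hr : r = 0 := by
        rw [mul_zero] at hj
        exact normSq_eq_zero.mp hj
      rw [h, hr, zero_add, map_mul, normSq_intCast] at hq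
      have hkd : (k : ℤ) ∣ p := ⟨normSq t, mul_left_cancel₀ hk0.ne' (by linear_combination -hq)⟩
      rcases (Nat.dvd_prime hp).mp (Int.natCast_dvd_natCast.mp hkd) with h | h <;> omega
    lift j to ℕ using hj0
    exact ih j (by omega) (by omega) (by omega) _ hnorm'
      (dvd_mul_of_coprime_mul (hcop k h0 hkp) hstep hqn)

end Descent

section Reduction

/-- Reduction of an integral vector modulo `p`. -/
def red (p : ℕ) (x : Fin 3 → ℤ) : Fin 3 → ZMod p := fun i => (x i : ZMod p)

theorem red_eq_zero_iff {p : ℕ} {x : Fin 3 → ℤ} : red p x = 0 ↔ ∀ i, (p : ℤ) ∣ x i := by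
  simp [funext_iff, red, ← ZMod.intCast_zmod_eq_zero_iff_dvd]

theorem red_dot {p : ℕ} (x y : Fin 3 → ℤ) :
    red p x ⬝ᵥ red p y = ((x ⬝ᵥ y : ℤ) : ZMod p) := by
  simp [dotProduct, red]

theorem dvd_dot_iff {p : ℕ} {x y : Fin 3 → ℤ} : (p : ℤ) ∣ x ⬝ᵥ y ↔ red p x ⬝ᵥ red p y = 0 := by
  rw [red_dot, ZMod.intCast_zmod_eq_zero_iff_dvd]

theorem red_surjective (p : ℕ) [NeZero p] : Function.Surjective (red p) := fun x =>
  ⟨fun i => (x i).val, by ext i; simp [red]⟩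

theorem exists_eq_smul_add_smul {p : ℕ} {g m : Fin 3 → ℤ} {r : ZMod p}
    (h : red p m = r • red p g) :
    ∃ (s : ℤ) (k : Fin 3 → ℤ), m = s • g + (p : ℤ) • k := by
  obtain ⟨s, rfl⟩ := ZMod.intCast_surjective r
  have hd : ∀ i, (p : ℤ) ∣ m i - s * g i := fun i => by
    rw [← ZMod.intCast_zmod_eq_zero_iff_dvd]
    have := congrFun h i
    simp only [red, Pi.smul_apply, smul_eq_mul] at this
    push_cast
    rw [this, sub_self]
  choose k hk using hd
  refine ⟨s, k, ?_⟩
  ext i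
  simp only [Pi.add_apply, Pi.smul_apply, smul_eq_mul]
  linarith [hk i]

end Reduction

section Matrices

/-- Integral matrices of size three. -/
abbrev Mat := Matrix (Fin 3) (Fin 3) ℤ

theorem dot_row_of_mul_transpose {M : Mat} {c : ℤ} (h : M * Mᵀ = c • 1) (i j : Fin 3) :
    M i ⬝ᵥ M j = if i = j then c else 0 := by
  have := congrFun (congrFun h i) j
  simpa [Matrix.mul_apply, dotProduct, Matrix.one_apply] using this

theorem dvd_dot_row {M : Mat} {c : ℤ} (h : M * Mᵀ = c • 1) (i j : Fin 3) : c ∣ M i ⬝ᵥ M j := by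
  rw [dot_row_of_mul_transpose h]; split_ifs <;> simp

theorem eq_zero_of_mul_eq_zero {M X : Mat} {c : ℤ} (hc : c ≠ 0) (h : M * Mᵀ = c • 1)
    (hX : M * X = 0) : X = 0 := by
  have hd : M.det ≠ 0 := fun h0 => by
    have := congrArg Matrix.det h
    rw [Matrix.det_mul, h0, zero_mul, Matrix.det_smul] at this
    simp only [Matrix.det_one, Fintype.card_fin, mul_one] at this
    exact pow_ne_zero 3 hc this.symm
  have h2 : M.adjugate * (M * X) = M.det • X := by
    rw [← Matrix.mul_assoc, Matrix.adjugate_mul, Matrix.smul_mul, Matrix.one_mul]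
  rw [hX, Matrix.mul_zero] at h2
  exact (smul_eq_zero.mp h2.symm).resolve_left hd

theorem transpose_mul_of_mul_transpose {M : Mat} {c : ℤ} (hc : c ≠ 0) (h : M * Mᵀ = c • 1) :
    Mᵀ * M = c • 1 := by
  rw [← sub_eq_zero]
  apply eq_zero_of_mul_eq_zero hc h
  rw [Matrix.mul_sub, ← Matrix.mul_assoc, h, Matrix.smul_mul, Matrix.mul_smul,
    Matrix.one_mul, Matrix.mul_one, sub_self]

/-- The orthogonal group of `ℤ³` as a set of matrices. -/
def orthoSet : Set Mat := {A | A * Aᵀ = 1}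

theorem transpose_mul_of_mem {A : Mat} (h : A ∈ orthoSet) : Aᵀ * A = 1 :=
  mul_eq_one_comm.mp h

/-- The integral vectors of norm one. -/
def unitVectors : Finset (Fin 3 → ℤ) :=
  {![1, 0, 0], ![-1, 0, 0], ![0, 1, 0], ![0, -1, 0], ![0, 0, 1], ![0, 0, -1]}

theorem mem_unitVectors_iff {x : Fin 3 → ℤ} : x ∈ unitVectors ↔ x ⬝ᵥ x = 1 := by
  constructor
  · revert x; decide
  · intro h
    obtain ⟨a, b, c, rfl⟩ : ∃ a b c, x = ![a, b, c] :=
      ⟨x 0, x 1, x 2, by ext i; fin_cases i <;> rfl⟩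
    simp [dotProduct, Fin.sum_univ_three] at h
    have ha : -1 ≤ a ∧ a ≤ 1 := by constructor <;> nlinarith
    have hb : -1 ≤ b ∧ b ≤ 1 := by constructor <;> nlinarith
    have hc : -1 ≤ c ∧ c ≤ 1 := by constructor <;> nlinarith
    obtain ⟨ha1, ha2⟩ := ha
    obtain ⟨hb1, hb2⟩ := hb
    obtain ⟨hc1, hc2⟩ := hc
    interval_cases a <;> interval_cases b <;> interval_cases c <;> simp at h <;> decide

theorem ncard_orthoSet : orthoSet.ncard = 48 := by
  let T := (unitVectors ×ˢ unitVectors ×ˢ unitVectors).filter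
    fun t => t.1 ⬝ᵥ t.2.1 = 0 ∧ t.1 ⬝ᵥ t.2.2 = 0 ∧ t.2.1 ⬝ᵥ t.2.2 = 0
  let f : (Fin 3 → ℤ) × (Fin 3 → ℤ) × (Fin 3 → ℤ) → Mat := fun t => ![t.1, t.2.1, t.2.2]
  have hf : Function.Injective f := fun s t h => by
    have h0 := congrFun h 0
    have h1 := congrFun h 1
    have h2 := congrFun h 2
    exact Prod.ext h0 (Prod.ext h1 h2)
  have hT : T.card = 48 := by decide +kernel
  have hO : orthoSet = f '' T := by
    ext A
    constructor
    · intro hA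
      have hd : A * Aᵀ = (1 : ℤ) • 1 := by rw [one_smul]; exact hA
      refine ⟨(A 0, A 1, A 2), ?_, ?_⟩
      · simp [T, mem_unitVectors_iff, dot_row_of_mul_transpose hd]
      · ext i j; fin_cases i <;> rfl
    · rintro ⟨⟨x, y, z⟩, ht, rfl⟩
      simp only [T, Finset.coe_filter, Finset.mem_product, mem_unitVectors_iff,
        Set.mem_ofPred_eq] at ht
      obtain ⟨⟨hx, hy, hz⟩, hxy, hxz, hyz⟩ := ht
      ext i j
      change f (x, y, z) i ⬝ᵥ f (x, y, z) j = _
      fin_cases i <;> fin_cases j <;> simp [f, *] <;> rwa [dotProduct_comm]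
  rw [hO, Set.ncard_image_of_injective _ hf, Set.ncard_coe_finset, hT]

theorem ncard_orthoSet_mul {M : Mat} {c : ℤ} (hc : c ≠ 0) (h : M * Mᵀ = c • 1) :
    ((· * M) '' orthoSet).ncard = 48 := by
  rw [Set.ncard_image_of_injective _, ncard_orthoSet]
  intro A B hAB
  have h2 := congrArg (· * Mᵀ) hAB
  simp only [Matrix.mul_assoc, h, Matrix.mul_smul, Matrix.mul_one] at h2
  exact smul_right_injective _ hc h2

/-- Integral similitudes of `ℤ³` of norm `p²`. -/
def simSet (p : ℕ) : Set Mat := {M | M * Mᵀ = ((p : ℤ) ^ 2) • 1}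

/-- Similitudes divisible by `p`. -/
def simZero (p : ℕ) : Set Mat := {M | M ∈ simSet p ∧ ∀ i, red p (M i) = 0}

/-- Similitudes not divisible by `p` with all rows orthogonal to `n` modulo `p`. -/
def simLine (p : ℕ) (n : Fin 3 → ℤ) : Set Mat :=
  {M | M ∈ simSet p ∧ (∃ i, red p (M i) ≠ 0) ∧ ∀ i, (p : ℤ) ∣ M i ⬝ᵥ n}

theorem mul_mem_simSet {p : ℕ} {A M : Mat} (hA : A ∈ orthoSet) (hM : M ∈ simSet p) :
    A * M ∈ simSet p := by
  have h1 : A * Aᵀ = 1 := hA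
  have h2 : M * Mᵀ = ((p : ℤ) ^ 2) • 1 := hM
  change A * M * (A * M)ᵀ = _
  rw [Matrix.transpose_mul, Matrix.mul_assoc, ← Matrix.mul_assoc M, h2, Matrix.smul_mul,
    Matrix.one_mul, Matrix.mul_smul, h1]

theorem mul_row_dot (A M : Mat) (n : Fin 3 → ℤ) (i : Fin 3) :
    (A * M) i ⬝ᵥ n = ∑ j, A i j * (M j ⬝ᵥ n) := by
  simp [dotProduct, Matrix.mul_apply, Fin.sum_univ_three]; ring

theorem red_mul_row_eq_zero {p : ℕ} {M : Mat} (h : ∀ i, red p (M i) = 0) (A : Mat) (i : Fin 3) :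
    red p ((A * M) i) = 0 := by
  rw [red_eq_zero_iff]
  intro k
  rw [Matrix.mul_apply]
  exact Finset.dvd_sum fun j _ => dvd_mul_of_dvd_right (red_eq_zero_iff.mp (h j) k) _

theorem ncard_simZero {p : ℕ} (hp : p ≠ 0) : (simZero p).ncard = 48 := by
  have hp0 : (p : ℤ) ≠ 0 := mod_cast hp
  have hI : ((p : ℤ) • (1 : Mat)) * ((p : ℤ) • (1 : Mat))ᵀ = ((p : ℤ) ^ 2) • 1 := by
    rw [Matrix.transpose_smul, Matrix.transpose_one, Matrix.smul_mul, Matrix.one_mul, smul_smul, sq]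
  rw [← ncard_orthoSet_mul (pow_ne_zero 2 hp0) hI]
  congr 1
  ext M
  constructor
  · rintro ⟨hM, h0⟩
    have hM' : M * Mᵀ = ((p : ℤ) ^ 2) • 1 := hM
    choose A hA using fun i => red_eq_zero_iff.mp (h0 i)
    have hMA : M = (p : ℤ) • Matrix.of A := by ext i j; simp [hA i j]
    refine ⟨Matrix.of A, ?_, by simp only [hMA, Matrix.mul_smul, Matrix.mul_one]⟩
    rw [hMA, Matrix.transpose_smul, Matrix.smul_mul, Matrix.mul_smul, smul_smul, ← sq] at hM'
    exact smul_right_injective _ (pow_ne_zero 2 hp0) hM'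
  · rintro ⟨A, hA, rfl⟩
    refine ⟨mul_mem_simSet hA hI, red_mul_row_eq_zero (fun i => ?_) A⟩
    rw [red_eq_zero_iff]
    intro j
    simp

theorem sq_dvd_dot_of_isotropic {p : ℕ} [Fact p.Prime] (hp : p ≠ 2) {g m : Fin 3 → ℤ}
    (hg : (p : ℤ) ^ 2 ∣ g ⬝ᵥ g) (hm : (p : ℤ) ^ 2 ∣ m ⬝ᵥ m) (hm0 : red p m ≠ 0)
    {r : ℤ} {k : Fin 3 → ℤ} (h : m = r • g + (p : ℤ) • k) : (p : ℤ) ^ 2 ∣ m ⬝ᵥ g := by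
  have hpp : Prime (p : ℤ) := Nat.prime_iff_prime_int.mp Fact.out
  have hr : ¬ (p : ℤ) ∣ r := fun hr => hm0 <| red_eq_zero_iff.mpr fun i => by
    rw [h]; simp [Dvd.dvd.mul_right hr]
  have h2 : ¬ (p : ℤ) ∣ 2 := fun h2 => hp <|
    (Nat.prime_dvd_prime_iff_eq Fact.out Nat.prime_two).mp (by exact_mod_cast h2)
  have e1 : m ⬝ᵥ m = r ^ 2 * (g ⬝ᵥ g) + p * (2 * r * (k ⬝ᵥ g)) + p ^ 2 * (k ⬝ᵥ k) := by
    rw [h]; simp [dotProduct, Fin.sum_univ_three]; ring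
  have e2 : m ⬝ᵥ g = r * (g ⬝ᵥ g) + p * (k ⬝ᵥ g) := by
    rw [h]; simp [dotProduct, Fin.sum_univ_three]; ring
  have h3 : (p : ℤ) ^ 2 ∣ p * (2 * r * (k ⬝ᵥ g)) := by
    have : (p : ℤ) * (2 * r * (k ⬝ᵥ g)) = m ⬝ᵥ m - r ^ 2 * (g ⬝ᵥ g) - p ^ 2 * (k ⬝ᵥ k) := by
      rw [e1]; ring
    rw [this]
    exact dvd_sub (dvd_sub hm (dvd_mul_of_dvd_right hg _)) (dvd_mul_right _ _)
  rw [sq] at h3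
  have h4 := (mul_dvd_mul_iff_left hpp.ne_zero).mp h3
  have h5 : (p : ℤ) ∣ k ⬝ᵥ g :=
    (hpp.dvd_or_dvd h4).resolve_left fun h => (hpp.dvd_or_dvd h).elim h2 hr
  rw [e2]
  refine dvd_add (dvd_mul_of_dvd_right hg _) ?_
  rw [sq]
  exact mul_dvd_mul_left _ h5

theorem sq_dvd_dot_of_parallel {p : ℕ} (hp : p ≠ 0) {g h m : Fin 3 → ℤ}
    (hg : (p : ℤ) ^ 2 ∣ g ⬝ᵥ g) (hgh : (p : ℤ) ^ 2 ∣ h ⬝ᵥ g) (hmg : (p : ℤ) ^ 2 ∣ m ⬝ᵥ g)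
    {r t : ℤ} {k l : Fin 3 → ℤ} (hm : m = r • g + (p : ℤ) • k) (hh : h = t • g + (p : ℤ) • l) :
    (p : ℤ) ^ 2 ∣ m ⬝ᵥ h := by
  have hp0 : (p : ℤ) ≠ 0 := mod_cast hp
  have e1 : h ⬝ᵥ g = t * (g ⬝ᵥ g) + p * (l ⬝ᵥ g) := by
    rw [hh]; simp [dotProduct, Fin.sum_univ_three]; ring
  have e2 : m ⬝ᵥ h = t * (m ⬝ᵥ g) + p * (r * (l ⬝ᵥ g) + p * (k ⬝ᵥ l)) := by
    have : m ⬝ᵥ h = t * (m ⬝ᵥ g) + p * (m ⬝ᵥ l) := by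
      rw [hh]; simp [dotProduct, Fin.sum_univ_three]; ring
    rw [this, show m ⬝ᵥ l = r * (l ⬝ᵥ g) + p * (k ⬝ᵥ l) by
      rw [hm]; simp [dotProduct, Fin.sum_univ_three]; ring]
  have h1 : (p : ℤ) ^ 2 ∣ p * (l ⬝ᵥ g) := by
    rw [show (p : ℤ) * (l ⬝ᵥ g) = h ⬝ᵥ g - t * (g ⬝ᵥ g) by rw [e1]; ring]
    exact dvd_sub hgh (dvd_mul_of_dvd_right hg _)
  rw [sq] at h1
  have h2 := (mul_dvd_mul_iff_left hp0).mp h1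
  rw [e2]
  refine dvd_add (dvd_mul_of_dvd_right hmg _) ?_
  rw [sq]
  exact mul_dvd_mul_left _ (dvd_add (dvd_mul_of_dvd_right h2 _) (dvd_mul_right _ _))

theorem red_row_isotropic {p : ℕ} {M : Mat} (hM : M ∈ simSet p) (i j : Fin 3) :
    red p (M i) ⬝ᵥ red p (M j) = 0 :=
  dvd_dot_iff.mp ((Dvd.intro_left _ (sq (p : ℤ)).symm).trans (dvd_dot_row hM i j))

theorem sq_dvd_dot_rows {p : ℕ} [Fact p.Prime] (hp : p ≠ 2) {n : Fin 3 → ℤ}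
    (hn : red p n ≠ 0) (hnn : (p : ℤ) ∣ n ⬝ᵥ n) {M L : Mat} (hM : M ∈ simLine p n)
    (hL : L ∈ simLine p n) (i j : Fin 3) : (p : ℤ) ^ 2 ∣ M i ⬝ᵥ L j := by
  obtain ⟨hM, ⟨i₀, hi₀⟩, hMn⟩ := hM
  obtain ⟨hL, ⟨j₀, hj₀⟩, hLn⟩ := hL
  have hp0 : p ≠ 0 := (Fact.out : p.Prime).ne_zero
  have par : ∀ K : Mat, K ∈ simSet p → (∀ i, (p : ℤ) ∣ K i ⬝ᵥ n) → ∀ i,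
      ∃ r : ZMod p, red p (K i) = r • red p n := fun K hK hKn i => by
    refine exists_eq_smul_of_isotropic hn (dvd_dot_iff.mp hnn) ?_ (red_row_isotropic hK i i)
    rw [dotProduct_comm]
    exact dvd_dot_iff.mp (hKn i)
  have cross : ∀ i j, red p (M i) ⬝ᵥ red p (L j) = 0 := fun i j => by
    obtain ⟨r, hr⟩ := par M hM hMn i
    obtain ⟨s, hs⟩ := par L hL hLn j
    rw [hr, hs, smul_dotProduct, dotProduct_smul, dvd_dot_iff.mp hnn]
    simp
  have liftM : ∀ i, ∃ (s : ℤ) (k : Fin 3 → ℤ), M i = s • L j₀ + (p : ℤ) • k := fun i => by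
    obtain ⟨r, hr⟩ := exists_eq_smul_of_isotropic (m := red p (M i)) hj₀
      (red_row_isotropic hL _ _) (by rw [dotProduct_comm]; exact cross _ _)
      (red_row_isotropic hM _ _)
    exact exists_eq_smul_add_smul hr
  have liftM' : ∀ i, ∃ (s : ℤ) (k : Fin 3 → ℤ), M i = s • M i₀ + (p : ℤ) • k := fun i => by
    obtain ⟨r, hr⟩ := exists_eq_smul_of_isotropic (m := red p (M i)) hi₀
      (red_row_isotropic hM _ _) (red_row_isotropic hM _ _) (red_row_isotropic hM _ _)
    exact exists_eq_smul_add_smul hr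
  have liftL : ∀ j, ∃ (s : ℤ) (k : Fin 3 → ℤ), L j = s • L j₀ + (p : ℤ) • k := fun j => by
    obtain ⟨r, hr⟩ := exists_eq_smul_of_isotropic (m := red p (L j)) hj₀
      (red_row_isotropic hL _ _) (red_row_isotropic hL _ _) (red_row_isotropic hL _ _)
    exact exists_eq_smul_add_smul hr
  have liftL' : ∃ (s : ℤ) (k : Fin 3 → ℤ), L j₀ = s • M i₀ + (p : ℤ) • k := by
    obtain ⟨r, hr⟩ := exists_eq_smul_of_isotropic (m := red p (L j₀)) hi₀
      (red_row_isotropic hM _ _) (cross _ _) (red_row_isotropic hL _ _)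
    exact exists_eq_smul_add_smul hr
  have step₀ : (p : ℤ) ^ 2 ∣ M i₀ ⬝ᵥ L j₀ := by
    obtain ⟨r, k, h⟩ := liftM i₀
    exact sq_dvd_dot_of_isotropic hp (dvd_dot_row hL _ _) (dvd_dot_row hM _ _) hi₀ h
  have step₁ : (p : ℤ) ^ 2 ∣ M i ⬝ᵥ L j₀ := by
    obtain ⟨r, k, h⟩ := liftL'
    obtain ⟨t, l, h'⟩ := liftM' i
    rw [dotProduct_comm]
    exact sq_dvd_dot_of_parallel hp0 (dvd_dot_row hM i₀ i₀) (dvd_dot_row hM _ _)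
      (by rwa [dotProduct_comm]) h h'
  obtain ⟨r, k, h⟩ := liftM i
  obtain ⟨t, l, h'⟩ := liftL j
  exact sq_dvd_dot_of_parallel hp0 (dvd_dot_row hL j₀ j₀) (dvd_dot_row hL _ _) step₁ h h'

theorem simLine_eq_image {p : ℕ} [Fact p.Prime] (hp : p ≠ 2) {n : Fin 3 → ℤ}
    (hn : red p n ≠ 0) (hnn : (p : ℤ) ∣ n ⬝ᵥ n) {L : Mat} (hL : L ∈ simLine p n) :
    simLine p n = (· * L) '' orthoSet := by
  have hp0 : (p : ℤ) ^ 2 ≠ 0 := pow_ne_zero 2 (mod_cast (Fact.out : p.Prime).ne_zero)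
  have hLt : Lᵀ * L = ((p : ℤ) ^ 2) • 1 := transpose_mul_of_mul_transpose hp0 hL.1
  ext M
  constructor
  · intro hM
    have hMM : M * Mᵀ = ((p : ℤ) ^ 2) • 1 := hM.1
    choose A hA using fun i j => sq_dvd_dot_rows hp hn hnn hM hL i j
    have hMA : M * Lᵀ = ((p : ℤ) ^ 2) • Matrix.of A := by
      ext i j
      exact hA i j
    have hAL : Matrix.of A * L = M := by
      apply smul_right_injective _ hp0
      simp only
      rw [← Matrix.smul_mul, ← hMA, Matrix.mul_assoc, hLt, Matrix.mul_smul, Matrix.mul_one]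
    refine ⟨Matrix.of A, ?_, hAL⟩
    rw [← hAL, Matrix.transpose_mul, Matrix.mul_assoc, ← Matrix.mul_assoc L,
      show L * Lᵀ = _ from hL.1, Matrix.smul_mul, Matrix.one_mul, Matrix.mul_smul] at hMM
    exact smul_right_injective _ hp0 hMM
  · rintro ⟨A, hA, rfl⟩
    refine ⟨mul_mem_simSet hA hL.1, ?_, fun i => ?_⟩
    · by_contra! h0
      obtain ⟨j, hj⟩ := hL.2.1
      apply hj
      have := red_mul_row_eq_zero h0 Aᵀ j
      rwa [← Matrix.mul_assoc, transpose_mul_of_mem hA, Matrix.one_mul] at this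
    · simp only [mul_row_dot]
      exact Finset.dvd_sum fun j _ => dvd_mul_of_dvd_right (hL.2.2 j) _

/-- The rotation `x ↦ α x ᾱ` of pure quaternions. -/
def rotationMatrix (α : ℍ[ℤ]) : Mat :=
  !![α.re ^ 2 + α.imI ^ 2 - α.imJ ^ 2 - α.imK ^ 2, 2 * (α.imI * α.imJ - α.re * α.imK),
      2 * (α.imI * α.imK + α.re * α.imJ);
    2 * (α.imI * α.imJ + α.re * α.imK), α.re ^ 2 - α.imI ^ 2 + α.imJ ^ 2 - α.imK ^ 2,
      2 * (α.imJ * α.imK - α.re * α.imI);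
    2 * (α.imI * α.imK - α.re * α.imJ), 2 * (α.imJ * α.imK + α.re * α.imI),
      α.re ^ 2 - α.imI ^ 2 - α.imJ ^ 2 + α.imK ^ 2]

theorem rotationMatrix_mul_transpose (α : ℍ[ℤ]) :
    rotationMatrix α * (rotationMatrix α)ᵀ = (normSq α ^ 2) • 1 := by
  rw [normSq_def']
  ext i j
  fin_cases i <;> fin_cases j <;>
    simp [rotationMatrix, Matrix.mul_apply, Fin.sum_univ_three] <;> ring

theorem exists_mem_simLine {p : ℕ} [Fact p.Prime] (hp : p ≠ 2) {n : Fin 3 → ℤ}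
    (hn : red p n ≠ 0) (hnn : (p : ℤ) ∣ n ⬝ᵥ n) : ∃ L, L ∈ simLine p n := by
  have hpr : p.Prime := Fact.out
  have hpp : Prime (p : ℤ) := Nat.prime_iff_prime_int.mp hpr
  have h2 : ¬ (p : ℤ) ∣ 2 := fun h2 => hp <|
    (Nat.prime_dvd_prime_iff_eq Fact.out Nat.prime_two).mp (by exact_mod_cast h2)
  have hp0 : (0 : ℤ) < p := mod_cast hpr.pos
  choose x t hx hlt using fun i => exists_abs_lt_of_odd (hpr.odd_of_ne_two hp) (n i)
  have hred : red p n = red p x := by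
    ext i; simp [red, hx i]
  have hxx : (p : ℤ) ∣ x ⬝ᵥ x := by
    rw [dvd_dot_iff] at hnn ⊢
    rwa [← hred]
  have hx0 : red p x ≠ 0 := hred ▸ hn
  obtain ⟨j, hj⟩ := hxx
  have hq : normSq (quat 0 (x 0) (x 1) (x 2)) = p * j := by
    rw [← hj, normSq_def']; simp [dotProduct, Fin.sum_univ_three]; ring
  have hj0 : 0 ≤ j := by
    have := normSq_nonneg (a := quat 0 (x 0) (x 1) (x 2))
    rw [hq] at this
    exact nonneg_of_mul_nonneg_right this hp0
  have hj1 : j ≠ 0 := by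
    rintro rfl
    rw [mul_zero, normSq_eq_zero] at hq
    apply hx0
    have e0 : x 0 = 0 := congrArg QuaternionAlgebra.imI hq
    have e1 : x 1 = 0 := congrArg QuaternionAlgebra.imJ hq
    have e2 : x 2 = 0 := congrArg QuaternionAlgebra.imK hq
    rw [red_eq_zero_iff]
    intro i
    fin_cases i <;> simp [e0, e1, e2]
  have hjp : j < p := by
    have key : ∀ i, 4 * x i ^ 2 < (p : ℤ) ^ 2 := fun i => by
      nlinarith [abs_nonneg (x i), sq_abs (x i), hlt i]
    simp only [dotProduct, Fin.sum_univ_three] at hj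
    have : (p : ℤ) * j < p * p := by nlinarith [key 0, key 1, key 2]
    exact lt_of_mul_lt_mul_left this hp0.le
  lift j to ℕ using hj0
  obtain ⟨α, hα, c, hc⟩ := exists_normSq_eq_of_dvd_mul hpr (quat 0 (x 0) (x 1) (x 2)) j
    (by omega) (by omega) (quat 0 (x 0) (x 1) (x 2)) (by rw [hq, mul_comm])
    ⟨((-j : ℤ) : ℍ[ℤ]), by
      rw [← Int.cast_mul, mul_neg, ← hj]
      ext <;> simp [dotProduct, Fin.sum_univ_three] <;> ring⟩
  have hα' := hα
  rw [normSq_def'] at hα'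
  have c0 := congrArg QuaternionAlgebra.re hc
  have c1 := congrArg QuaternionAlgebra.imI hc
  have c2 := congrArg QuaternionAlgebra.imJ hc
  have c3 := congrArg QuaternionAlgebra.imK hc
  simp at c0 c1 c2 c3
  refine ⟨rotationMatrix α, ?_, ?_, fun i => ?_⟩
  · have := rotationMatrix_mul_transpose α
    rwa [hα] at this
  · by_contra! h0
    have d0 := red_eq_zero_iff.mp (h0 0) 0
    have d1 := red_eq_zero_iff.mp (h0 1) 1
    have d2 := red_eq_zero_iff.mp (h0 2) 2
    simp [rotationMatrix] at d0 d1 d2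
    have half : ∀ y : ℤ, (p : ℤ) ∣ 2 * (2 * y ^ 2) → (p : ℤ) ∣ y := fun y hy =>
      hpp.dvd_of_dvd_pow
        ((hpp.dvd_or_dvd ((hpp.dvd_or_dvd hy).resolve_left h2)).resolve_left h2)
    have a0 : (p : ℤ) ∣ α.re := half _ <| by
      rw [show 2 * (2 * α.re ^ 2) = p + (α.re ^ 2 + α.imI ^ 2 - α.imJ ^ 2 - α.imK ^ 2)
        + (α.re ^ 2 - α.imI ^ 2 + α.imJ ^ 2 - α.imK ^ 2)
        + (α.re ^ 2 - α.imI ^ 2 - α.imJ ^ 2 + α.imK ^ 2) by rw [← hα']; ring]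
      exact dvd_add (dvd_add (dvd_add dvd_rfl d0) d1) d2
    have a1 : (p : ℤ) ∣ α.imI := half _ <| by
      rw [show 2 * (2 * α.imI ^ 2) = p + (α.re ^ 2 + α.imI ^ 2 - α.imJ ^ 2 - α.imK ^ 2)
        - (α.re ^ 2 - α.imI ^ 2 + α.imJ ^ 2 - α.imK ^ 2)
        - (α.re ^ 2 - α.imI ^ 2 - α.imJ ^ 2 + α.imK ^ 2) by rw [← hα']; ring]
      exact dvd_sub (dvd_sub (dvd_add dvd_rfl d0) d1) d2
    have a2 : (p : ℤ) ∣ α.imJ := half _ <| by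
      rw [show 2 * (2 * α.imJ ^ 2) = p - (α.re ^ 2 + α.imI ^ 2 - α.imJ ^ 2 - α.imK ^ 2)
        + (α.re ^ 2 - α.imI ^ 2 + α.imJ ^ 2 - α.imK ^ 2)
        - (α.re ^ 2 - α.imI ^ 2 - α.imJ ^ 2 + α.imK ^ 2) by rw [← hα']; ring]
      exact dvd_sub (dvd_add (dvd_sub dvd_rfl d0) d1) d2
    have a3 : (p : ℤ) ∣ α.imK := half _ <| by
      rw [show 2 * (2 * α.imK ^ 2) = p - (α.re ^ 2 + α.imI ^ 2 - α.imJ ^ 2 - α.imK ^ 2)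
        - (α.re ^ 2 - α.imI ^ 2 + α.imJ ^ 2 - α.imK ^ 2)
        + (α.re ^ 2 - α.imI ^ 2 - α.imJ ^ 2 + α.imK ^ 2) by rw [← hα']; ring]
      exact dvd_add (dvd_sub (dvd_sub dvd_rfl d0) d1) d2
    have hdvd : (p : ℤ) ^ 2 ∣ p := by
      conv_rhs => rw [← hα']
      exact dvd_add (dvd_add (dvd_add (pow_dvd_pow_of_dvd a0 2) (pow_dvd_pow_of_dvd a1 2))
        (pow_dvd_pow_of_dvd a2 2)) (pow_dvd_pow_of_dvd a3 2)
    have := Int.le_of_dvd hp0 hdvd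
    have h1p : (1 : ℤ) < p := mod_cast hpr.one_lt
    nlinarith
  · have hi : (p : ℤ) ∣ rotationMatrix α i ⬝ᵥ x := by
      fin_cases i
      · refine ⟨α.re * c.imI - α.imI * c.re + α.imJ * c.imK - α.imK * c.imJ, ?_⟩
        simp [rotationMatrix, dotProduct, Fin.sum_univ_three]
        linear_combination α.re * c1 - α.imI * c0 + α.imJ * c3 - α.imK * c2
      · refine ⟨α.re * c.imJ - α.imI * c.imK - α.imJ * c.re + α.imK * c.imI, ?_⟩
        simp [rotationMatrix, dotProduct, Fin.sum_univ_three]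
        linear_combination α.re * c2 - α.imI * c3 - α.imJ * c0 + α.imK * c1
      · refine ⟨α.re * c.imK + α.imI * c.imJ - α.imJ * c.imI - α.imK * c.re, ?_⟩
        simp [rotationMatrix, dotProduct, Fin.sum_univ_three]
        linear_combination α.re * c3 + α.imI * c2 - α.imJ * c1 - α.imK * c0
    rw [dvd_dot_iff] at hi ⊢
    rwa [hred]

theorem ncard_simLine {p : ℕ} [Fact p.Prime] (hp : p ≠ 2) {n : Fin 3 → ℤ}
    (hn : red p n ≠ 0) (hnn : (p : ℤ) ∣ n ⬝ᵥ n) : (simLine p n).ncard = 48 := by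
  obtain ⟨L, hL⟩ := exists_mem_simLine hp hn hnn
  rw [simLine_eq_image hp hn hnn hL]
  exact ncard_orthoSet_mul (pow_ne_zero 2 (mod_cast (Fact.out : p.Prime).ne_zero)) hL.1

/-- The matrix attached to a triple `(u, v, w)`. -/
def tripleMatrix (p : ℕ) (a b : ℤ) (t : (Fin 3 → ℤ) × (Fin 3 → ℤ) × (Fin 3 → ℤ)) : Mat :=
  Matrix.of fun i => ![p * t.1 i - a * t.2.1 i - b * t.2.2 i, t.2.1 i, t.2.2 i]

theorem tripleMatrix_injective {p : ℕ} (hp : p ≠ 0) (a b : ℤ) :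
    Function.Injective (tripleMatrix p a b) := by
  have hp0 : (p : ℤ) ≠ 0 := mod_cast hp
  rintro ⟨u, v, w⟩ ⟨u', v', w'⟩ h
  have hv : v = v' := by ext i; simpa [tripleMatrix] using congrFun (congrFun h i) 1
  have hw : w = w' := by ext i; simpa [tripleMatrix] using congrFun (congrFun h i) 2
  subst hv hw
  have hu : u = u' := by
    ext i
    have := congrFun (congrFun h i) 0
    simp only [tripleMatrix, Matrix.of_apply, Matrix.cons_val_zero] at this
    exact mul_left_cancel₀ hp0 (by linarith)
  rw [hu]

theorem tripleMatrix_mem_simSet_iff {p : ℕ} (hp : p ≠ 0) (a b : ℤ)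
    (t : (Fin 3 → ℤ) × (Fin 3 → ℤ) × (Fin 3 → ℤ)) :
    tripleMatrix p a b t ∈ simSet p ↔
      (∑ i : Fin 3, t.1 i * t.1 i) = a ^ 2 + b ^ 2 + 1 ∧
      (∑ i : Fin 3, t.2.1 i * t.2.1 i) = (p : ℤ) ^ 2 ∧
      (∑ i : Fin 3, t.2.2 i * t.2.2 i) = (p : ℤ) ^ 2 ∧
      (∑ i : Fin 3, t.1 i * t.2.1 i) = a * (p : ℤ) ∧
      (∑ i : Fin 3, t.1 i * t.2.2 i) = b * (p : ℤ) ∧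
      (∑ i : Fin 3, t.2.1 i * t.2.2 i) = 0 := by
  have hp0 : (p : ℤ) ≠ 0 := mod_cast hp
  have hp2 : (p : ℤ) ^ 2 ≠ 0 := pow_ne_zero 2 hp0
  have hiff : tripleMatrix p a b t ∈ simSet p ↔
      (tripleMatrix p a b t)ᵀ * tripleMatrix p a b t = ((p : ℤ) ^ 2) • 1 := by
    refine ⟨transpose_mul_of_mul_transpose hp2, fun h => ?_⟩
    have := transpose_mul_of_mul_transpose (M := (tripleMatrix p a b t)ᵀ) hp2
      (by rwa [Matrix.transpose_transpose])
    rwa [Matrix.transpose_transpose] at this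
  rw [hiff]
  obtain ⟨u, v, w⟩ := t
  simp only [Fin.sum_univ_three]
  constructor
  · intro h
    have e := fun i j => congrFun (congrFun h i) j
    have e00 := e 0 0
    have e01 := e 0 1
    have e02 := e 0 2
    have e11 := e 1 1
    have e12 := e 1 2
    have e22 := e 2 2
    simp [tripleMatrix, Matrix.mul_apply, Fin.sum_univ_three, -zsmul_eq_mul]
      at e00 e01 e02 e11 e12 e22
    have huv : u 0 * v 0 + u 1 * v 1 + u 2 * v 2 = a * p :=
      mul_left_cancel₀ hp0 (by linear_combination e01 + a * e11 + b * e12)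
    have huw : u 0 * w 0 + u 1 * w 1 + u 2 * w 2 = b * p :=
      mul_left_cancel₀ hp0 (by linear_combination e02 + a * e12 + b * e22)
    refine ⟨mul_left_cancel₀ hp2 ?_, by linear_combination e11, by linear_combination e22,
      huv, huw, by linear_combination e12⟩
    linear_combination e00 + 2 * a * p * huv + 2 * b * p * huw - a ^ 2 * e11 - b ^ 2 * e22
      - 2 * a * b * e12
  · rintro ⟨huu, hvv, hww, huv, huw, hvw⟩
    have e01 : (p * u 0 - a * v 0 - b * w 0) * v 0 + (p * u 1 - a * v 1 - b * w 1) * v 1 +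
        (p * u 2 - a * v 2 - b * w 2) * v 2 = 0 := by
      linear_combination p * huv - a * hvv - b * hvw
    have e02 : (p * u 0 - a * v 0 - b * w 0) * w 0 + (p * u 1 - a * v 1 - b * w 1) * w 1 +
        (p * u 2 - a * v 2 - b * w 2) * w 2 = 0 := by
      linear_combination p * huw - a * hvw - b * hww
    have e00 : (p * u 0 - a * v 0 - b * w 0) * (p * u 0 - a * v 0 - b * w 0) +
        (p * u 1 - a * v 1 - b * w 1) * (p * u 1 - a * v 1 - b * w 1) +
        (p * u 2 - a * v 2 - b * w 2) * (p * u 2 - a * v 2 - b * w 2) = (p : ℤ) ^ 2 := by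
      linear_combination p ^ 2 * huu + a ^ 2 * hvv + b ^ 2 * hww - 2 * a * p * huv
        - 2 * b * p * huw + 2 * a * b * hvw
    ext i j
    fin_cases i <;> fin_cases j <;>
      simp [tripleMatrix, Matrix.mul_apply, Fin.sum_univ_three] <;> linarith

/-- Integral similitudes with all rows orthogonal to `c` modulo `p`. -/
def simOrtho (p : ℕ) (c : Fin 3 → ℤ) : Set Mat :=
  {M | M ∈ simSet p ∧ ∀ i, (p : ℤ) ∣ M i ⬝ᵥ c}

theorem card_triples {p : ℕ} (hp : p ≠ 0) (a b : ℤ) :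
    Nat.card {t : (Fin 3 → ℤ) × (Fin 3 → ℤ) × (Fin 3 → ℤ) //
      (∑ i : Fin 3, t.1 i * t.1 i) = a ^ 2 + b ^ 2 + 1 ∧
      (∑ i : Fin 3, t.2.1 i * t.2.1 i) = (p : ℤ) ^ 2 ∧
      (∑ i : Fin 3, t.2.2 i * t.2.2 i) = (p : ℤ) ^ 2 ∧
      (∑ i : Fin 3, t.1 i * t.2.1 i) = a * (p : ℤ) ∧
      (∑ i : Fin 3, t.1 i * t.2.2 i) = b * (p : ℤ) ∧
      (∑ i : Fin 3, t.2.1 i * t.2.2 i) = 0} = (simOrtho p ![1, a, b]).ncard := by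
  simp only [← tripleMatrix_mem_simSet_iff hp a b]
  have himage : simOrtho p ![1, a, b] =
      tripleMatrix p a b '' {t | tripleMatrix p a b t ∈ simSet p} := by
    ext M
    constructor
    · rintro ⟨hM, hMc⟩
      choose u hu using hMc
      have hMu : tripleMatrix p a b (u, fun i => M i 1, fun i => M i 2) = M := by
        ext i j
        have := hu i
        simp [dotProduct, Fin.sum_univ_three] at this
        fin_cases j <;> simp [tripleMatrix]
        linarith
      exact ⟨_, by rwa [Set.mem_ofPred_eq, hMu], hMu⟩
    · rintro ⟨t, ht, rfl⟩
      refine ⟨ht, fun i => ⟨t.1 i, ?_⟩⟩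
      simp [tripleMatrix, dotProduct, Fin.sum_univ_three]
      ring
  rw [himage, Set.ncard_image_of_injective _ (tripleMatrix_injective hp a b)]
  rfl

theorem simZero_subset_simOrtho (p : ℕ) (c : Fin 3 → ℤ) : simZero p ⊆ simOrtho p c :=
  fun M hM => ⟨hM.1, fun i => by rw [dvd_dot_iff, hM.2 i, zero_dotProduct]⟩

theorem disjoint_simZero_simLine (p : ℕ) (n : Fin 3 → ℤ) : Disjoint (simZero p) (simLine p n) :=
  Set.disjoint_left.mpr fun _ h0 h1 => h1.2.1.elim fun i hi => hi (h0.2 i)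

theorem simOrtho_eq_union (p : ℕ) (c : Fin 3 → ℤ) : simOrtho p c = simZero p ∪ simLine p c := by
  ext M
  constructor
  · intro hM
    by_cases h : ∀ i, red p (M i) = 0
    · exact Or.inl ⟨hM.1, h⟩
    · exact Or.inr ⟨hM.1, by simpa using h, hM.2⟩
  · rintro (hM | hM)
    · exact simZero_subset_simOrtho p c hM
    · exact ⟨hM.1, hM.2.2⟩

theorem finite_of_ncard_eq {s : Set Mat} (h : s.ncard = 48) : s.Finite :=
  Set.finite_of_ncard_ne_zero (by omega)

theorem ncard_simOrtho_of_dvd {p : ℕ} [Fact p.Prime] (hp : p ≠ 2) {c : Fin 3 → ℤ}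
    (hc : red p c ≠ 0) (h : (p : ℤ) ∣ c ⬝ᵥ c) : (simOrtho p c).ncard = 96 := by
  have h0 := ncard_simZero (Fact.out : p.Prime).ne_zero
  have h1 := ncard_simLine hp hc h
  rw [simOrtho_eq_union, Set.ncard_union_eq (disjoint_simZero_simLine p c)
    (finite_of_ncard_eq h0) (finite_of_ncard_eq h1), h0, h1]

theorem exists_sq_of_mem_simLine {p : ℕ} [Fact p.Prime] {c : Fin 3 → ℤ} {M : Mat}
    (hM : M ∈ simLine p c) {i : Fin 3} (hi : red p (M i) ≠ 0) :
    ∃ s : ZMod p, red p c ⨯₃ red p (M i) = s • red p (M i) ∧ s ^ 2 = -(red p c ⬝ᵥ red p c) :=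
  exists_sq_eq_of_isotropic_of_dot_eq_zero hi (red_row_isotropic hM.1 i i)
    (by rw [dotProduct_comm]; exact dvd_dot_iff.mp (hM.2.2 i))

theorem ncard_simOrtho_of_not_isSquare {p : ℕ} [Fact p.Prime] {c : Fin 3 → ℤ}
    (h : ¬ IsSquare (-(red p c ⬝ᵥ red p c))) : (simOrtho p c).ncard = 48 := by
  have he : simLine p c = ∅ := by
    rw [Set.eq_empty_iff_forall_notMem]
    intro M hM
    obtain ⟨i, hi⟩ := hM.2.1
    obtain ⟨s, -, hs⟩ := exists_sq_of_mem_simLine hM hi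
    exact h ⟨s, by rw [← hs, sq]⟩
  rw [simOrtho_eq_union, he, Set.union_empty, ncard_simZero (Fact.out : p.Prime).ne_zero]

theorem exists_smul_of_mem_simLine {p : ℕ} {n : Fin 3 → ℤ} [Fact p.Prime]
    (hn : red p n ≠ 0) (hnn : (p : ℤ) ∣ n ⬝ᵥ n) {M : Mat} (hM : M ∈ simLine p n) (i : Fin 3) :
    ∃ r : ZMod p, red p (M i) = r • red p n :=
  exists_eq_smul_of_isotropic hn (dvd_dot_iff.mp hnn)
    (by rw [dotProduct_comm]; exact dvd_dot_iff.mp (hM.2.2 i)) (red_row_isotropic hM.1 i i)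

theorem simLine_subset_simOrtho {p : ℕ} [Fact p.Prime] {c n : Fin 3 → ℤ} (hn : red p n ≠ 0)
    (hnn : (p : ℤ) ∣ n ⬝ᵥ n) (hcn : red p c ⬝ᵥ red p n = 0) : simLine p n ⊆ simOrtho p c := by
  refine fun M hM => ⟨hM.1, fun i => ?_⟩
  obtain ⟨r, hr⟩ := exists_smul_of_mem_simLine hn hnn hM i
  rw [dvd_dot_iff, hr, smul_dotProduct, dotProduct_comm, hcn, smul_zero]

theorem mem_simLine_of_row {p : ℕ} [Fact p.Prime] {n : Fin 3 → ℤ} {M : Mat}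
    (hM : M ∈ simSet p) {i : Fin 3} (hi : red p (M i) ≠ 0)
    (hin : red p (M i) ⬝ᵥ red p n = 0) : M ∈ simLine p n := by
  refine ⟨hM, ⟨i, hi⟩, fun j => ?_⟩
  obtain ⟨r, hr⟩ := exists_eq_smul_of_isotropic hi (red_row_isotropic hM i i)
    (red_row_isotropic hM i j) (red_row_isotropic hM j j)
  rw [dvd_dot_iff, hr, smul_dotProduct, hin, smul_zero]

theorem disjoint_simLine {p : ℕ} [Fact p.Prime] {m n : Fin 3 → ℤ} (hm : red p m ≠ 0)
    (hmm : (p : ℤ) ∣ m ⬝ᵥ m) (hmn : red p m ⬝ᵥ red p n ≠ 0) :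
    Disjoint (simLine p m) (simLine p n) := by
  rw [Set.disjoint_left]
  intro M h1 h2
  obtain ⟨i, hi⟩ := h1.2.1
  obtain ⟨r, hr⟩ := exists_smul_of_mem_simLine hm hmm h1 i
  have h := dvd_dot_iff.mp (h2.2.2 i)
  rw [hr, smul_dotProduct, smul_eq_mul, mul_eq_zero] at h
  rcases h with h | h
  · rw [hr, h, zero_smul] at hi
    exact hi rfl
  · exact hmn h

theorem ncard_simOrtho_of_sq_eq {p : ℕ} [Fact p.Prime] (hp : p ≠ 2) {c : Fin 3 → ℤ} {d : ZMod p}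
    (hd : d ≠ 0) (h : d ^ 2 = -(red p c ⬝ᵥ red p c)) : (simOrtho p c).ncard = 144 := by
  have hpr : p.Prime := Fact.out
  have h2 : (2 : ZMod p) ≠ 0 := by
    have : ((2 : ℕ) : ZMod p) ≠ 0 := by
      rw [Ne, ZMod.natCast_eq_zero_iff]
      exact fun h => hp ((Nat.prime_dvd_prime_iff_eq hpr Nat.prime_two).mp h)
    simpa using this
  obtain ⟨m', hm, hmm, hcm, hem⟩ := exists_isotropic_eigenvector hd h
  obtain ⟨n', hn, hnn, hcn, hen⟩ := exists_isotropic_eigenvector (neg_ne_zero.mpr hd)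
    (by rw [neg_sq, h])
  obtain ⟨m, rfl⟩ := red_surjective p m'
  obtain ⟨n, rfl⟩ := red_surjective p n'
  rw [← dvd_dot_iff] at hmm hnn
  have hmn : red p m ⬝ᵥ red p n ≠ 0 := fun h0 => by
    obtain ⟨r, hr⟩ := exists_eq_smul_of_isotropic hm (dvd_dot_iff.mp hmm) h0 (dvd_dot_iff.mp hnn)
    have e := hen
    rw [hr, map_smul, hem, smul_comm, ← hr] at e
    have := smul_left_injective _ hn e
    have h3 : 2 * d = 0 := by linear_combination this
    exact (mul_ne_zero h2 hd) h3
  have hset : simOrtho p c = simZero p ∪ (simLine p m ∪ simLine p n) := by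
    refine Set.Subset.antisymm (fun M hM => ?_) (Set.union_subset (simZero_subset_simOrtho p c)
      (Set.union_subset (simLine_subset_simOrtho hm hmm hcm) (simLine_subset_simOrtho hn hnn hcn)))
    rw [simOrtho_eq_union] at hM
    refine hM.imp_right fun hM => ?_
    obtain ⟨i, hi⟩ := hM.2.1
    obtain ⟨s, hs, hs2⟩ := exists_sq_of_mem_simLine hM hi
    rw [← h] at hs2
    rcases sq_eq_sq_iff_eq_or_eq_neg.mp hs2 with rfl | rfl
    · exact Or.inl (mem_simLine_of_row hM.1 hi
        (dot_eq_zero_of_eigenvectors (mul_ne_zero h2 hd) hs hem))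
    · exact Or.inr (mem_simLine_of_row hM.1 hi
        (dot_eq_zero_of_eigenvectors (mul_ne_zero h2 (neg_ne_zero.mpr hd)) hs hen))
  have h0 := ncard_simZero hpr.ne_zero
  have h1 := ncard_simLine hp hm hmm
  have h1' := ncard_simLine hp hn hnn
  have f0 := finite_of_ncard_eq h0
  have f1 := finite_of_ncard_eq h1
  have f1' := finite_of_ncard_eq h1'
  rw [hset, Set.ncard_union_eq (Set.disjoint_union_right.mpr ⟨disjoint_simZero_simLine p m,
    disjoint_simZero_simLine p n⟩) f0 (f1.union f1'),
    Set.ncard_union_eq (disjoint_simLine hm hmm hmn) f1 f1', h0, h1, h1']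

end Matrices

/-- For an odd prime `p` and integers `a`, `b` with `ε = a² + b² + 1`, the number `N` of
triples `(u, v, w)` of vectors in `ℤ³` with `u·u = ε`, `v·v = p²`, `w·w = p²`,
`u·v = a·p`, `u·w = b·p`, `v·w = 0` is `144` if `(−ε/p) = 1`, `48` if `(−ε/p) = −1`,
and `96` if `p ∣ ε`. -/
theorem stmt_0 (p : ℕ) [Fact p.Prime] (hp : p ≠ 2) (a b : ℤ) (ε : ℤ)
    (hε : ε = a ^ 2 + b ^ 2 + 1)
    (N : ℕ)
    (hN : N = Nat.card {t : (Fin 3 → ℤ) × (Fin 3 → ℤ) × (Fin 3 → ℤ) //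
      (∑ i : Fin 3, t.1 i * t.1 i) = ε ∧
      (∑ i : Fin 3, t.2.1 i * t.2.1 i) = (p : ℤ) ^ 2 ∧
      (∑ i : Fin 3, t.2.2 i * t.2.2 i) = (p : ℤ) ^ 2 ∧
      (∑ i : Fin 3, t.1 i * t.2.1 i) = a * (p : ℤ) ∧
      (∑ i : Fin 3, t.1 i * t.2.2 i) = b * (p : ℤ) ∧
      (∑ i : Fin 3, t.2.1 i * t.2.2 i) = 0}) :
    (legendreSym p (-ε) = 1 → N = 144) ∧
    (legendreSym p (-ε) = -1 → N = 48) ∧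
    ((p : ℤ) ∣ ε → N = 96) := by
  have hp0 : p ≠ 0 := (Fact.out : p.Prime).ne_zero
  subst hε
  rw [card_triples hp0] at hN
  have hc : ![1, a, b] ⬝ᵥ ![1, a, b] = a ^ 2 + b ^ 2 + 1 := by
    simp [dotProduct, Fin.sum_univ_three]; ring
  have hcred : -(red p ![1, a, b] ⬝ᵥ red p ![1, a, b]) =
      ((-(a ^ 2 + b ^ 2 + 1) : ℤ) : ZMod p) := by
    rw [red_dot, hc, Int.cast_neg]
  rw [hN]
  refine ⟨fun h => ?_, fun h => ?_, fun h => ?_⟩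
  · have hne : ((-(a ^ 2 + b ^ 2 + 1) : ℤ) : ZMod p) ≠ 0 := fun h0 => by
      rw [(legendreSym.eq_zero_iff p _).mpr h0] at h
      norm_num at h
    obtain ⟨d, hd⟩ := (legendreSym.eq_one_iff p hne).mp h
    refine ncard_simOrtho_of_sq_eq hp (d := d) ?_ (by rw [hcred, hd, sq])
    rintro rfl
    exact hne (by rw [hd, mul_zero])
  · refine ncard_simOrtho_of_not_isSquare ?_
    rw [hcred]
    exact (legendreSym.eq_neg_one_iff p).mp h
  · refine ncard_simOrtho_of_dvd hp ?_ (by rwa [hc])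
    intro h0
    have := congrFun h0 0
    simp [red] at this
end

section
/- Let a and b be integers, not both zero, such that a² + b² ∉ {1, 2, 5, 8, 18, 250}. Then there exist integers x and y satisfying: (i) (5a)² + (5b)² = x² + y²; (ii) x² ≥ 10 and y² ≥ 10; (iii) x·y is not divisible by 5. -/
/-- The linear map with matrix `!![a, b; c, d]` acting on pairs of natural numbers. -/
def linStep (a b c d : ℕ) (v : ℕ × ℕ) : ℕ × ℕ :=
  (a * v.1 + b * v.2, c * v.1 + d * v.2)

/-- `linStep` with both coordinates reduced modulo `Q`. -/
def linStepMod (Q a b c d : ℕ) (v : ℕ × ℕ) : ℕ × ℕ :=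
  ((a * v.1 + b * v.2) % Q, (c * v.1 + d * v.2) % Q)

theorem linStep_iterate_mod (Q a b c d : ℕ) (s : ℕ × ℕ) (n : ℕ) :
    (((linStep a b c d)^[n] s).1 % Q, ((linStep a b c d)^[n] s).2 % Q) =
      (linStepMod Q a b c d)^[n] (s.1 % Q, s.2 % Q) := by
  induction n with
  | zero => rfl
  | succ n ih =>
    rw [Function.iterate_succ_apply', Function.iterate_succ_apply', ← ih]
    simp [linStep, linStepMod, Nat.add_mod, Nat.mul_mod]

/-- A decidable property of the second coordinate mod `Q` that holds over one period of the
reduced orbit holds along the whole orbit. -/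
theorem linStep_iterate_of_period {Q a b c d L : ℕ} {s : ℕ × ℕ} (T : ℕ → Prop) (hL : 0 < L)
    (hper : (linStepMod Q a b c d)^[L] (s.1 % Q, s.2 % Q) = (s.1 % Q, s.2 % Q))
    (hT : ∀ n < L, T ((linStepMod Q a b c d)^[n] (s.1 % Q, s.2 % Q)).2) (n : ℕ) :
    T (((linStep a b c d)^[n] s).2 % Q) := by
  have h := congrArg Prod.snd (linStep_iterate_mod Q a b c d s n)
  have hp : Function.IsPeriodicPt (linStepMod Q a b c d) L (s.1 % Q, s.2 % Q) := hper
  rw [← hp.iterate_mod_apply] at h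
  simp only at h
  rw [h]
  exact hT _ (Nat.mod_lt _ hL)

/-- Descent: if every solution outside of `B` comes from a smaller one by `f`, then all
solutions lie on the orbits of `B`. -/
theorem exists_iterate_of_descent {P B : ℕ × ℕ → Prop} {f : ℕ × ℕ → ℕ × ℕ}
    (h : ∀ v, P v → B v ∨ ∃ w, P w ∧ w.2 < v.2 ∧ f w = v) (v : ℕ × ℕ) (hv : P v) :
    ∃ n s, B s ∧ f^[n] s = v := by
  induction hk : v.2 using Nat.strong_induction_on generalizing v with
  | _ k ih =>
    rcases h v hv with hB | ⟨w, hw, hlt, rfl⟩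
    · exact ⟨0, v, hB, rfl⟩
    · obtain ⟨n, s, hs, rfl⟩ := ih w.2 (hk ▸ hlt) w hw rfl
      exact ⟨n + 1, s, hs, Function.iterate_succ_apply' _ _ _⟩

theorem exists_iterate_of_sq_add_mul_add_one {w z : ℕ} (h : w ^ 2 + z * w + 1 = z ^ 2) :
    ∃ n, (linStep 1 1 1 2)^[n] (0, 1) = (w, z) := by
  obtain ⟨n, s, rfl, hn⟩ := exists_iterate_of_descent
    (P := fun v => v.1 ^ 2 + v.2 * v.1 + 1 = v.2 ^ 2) (B := fun v => v = (0, 1))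
    (f := linStep 1 1 1 2) (by
      rintro ⟨w, z⟩ h
      simp only at h
      rcases Nat.eq_zero_or_pos w with rfl | hw
      · left
        have : z = 1 := by nlinarith
        rw [this]
      · right
        have h1 : w ≤ z := by nlinarith
        have h2 : z ≤ 2 * w := by
          by_contra! hc
          nlinarith
        obtain ⟨p, rfl⟩ := Nat.exists_eq_add_of_le h1
        obtain ⟨q, rfl⟩ : ∃ q, w = p + q := Nat.exists_eq_add_of_le (by omega)
        refine ⟨(q, p), ?_, ?_, ?_⟩
        · simp only
          nlinarith
        · simp only
          omega
        · simp only [linStep, Prod.mk.injEq]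
          omega) (w, z) h
  exact ⟨n, hn⟩

theorem exists_iterate_of_sq_add_one_eq_two_mul_sq {y z : ℕ} (h : y ^ 2 + 1 = 2 * z ^ 2) :
    ∃ n, (linStep 3 4 2 3)^[n] (1, 1) = (y, z) := by
  obtain ⟨n, s, rfl, hn⟩ := exists_iterate_of_descent
    (P := fun v => v.1 ^ 2 + 1 = 2 * v.2 ^ 2) (B := fun v => v = (1, 1))
    (f := linStep 3 4 2 3) (by
      rintro ⟨y, z⟩ h
      simp only at h
      rcases Nat.lt_or_ge z 2 with hz | hz
      · left
        interval_cases z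
        · omega
        · have : y = 1 := by nlinarith
          rw [this]
      · right
        have h1 : 4 * z ≤ 3 * y := by nlinarith
        have h2 : 2 * y ≤ 3 * z := by nlinarith
        obtain ⟨p, hp⟩ := Nat.exists_eq_add_of_le h1
        obtain ⟨q, hq⟩ := Nat.exists_eq_add_of_le h2
        have hy : y = 3 * p + 4 * q := by omega
        have hz' : z = 2 * p + 3 * q := by omega
        refine ⟨(p, q), ?_, ?_, ?_⟩
        · subst hy hz'
          simp only
          nlinarith
        · simp only
          nlinarith
        · simp only [linStep, Prod.mk.injEq]
          omega) (y, z) h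
  exact ⟨n, hn⟩

theorem exists_iterate_of_sq_add_one_eq_ten_mul_sq {y z : ℕ} (h : y ^ 2 + 1 = 10 * z ^ 2) :
    ∃ n, (linStep 19 60 6 19)^[n] (3, 1) = (y, z) := by
  obtain ⟨n, s, rfl, hn⟩ := exists_iterate_of_descent
    (P := fun v => v.1 ^ 2 + 1 = 10 * v.2 ^ 2) (B := fun v => v = (3, 1))
    (f := linStep 19 60 6 19) (by
      rintro ⟨y, z⟩ h
      simp only at h
      rcases Nat.lt_or_ge z 7 with hz | hz
      · left
        have hy : y < 20 := by nlinarith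
        interval_cases z <;> interval_cases y <;> first | rfl | omega
      · right
        have h1 : 60 * z ≤ 19 * y := by nlinarith
        have h2 : 6 * y ≤ 19 * z := by nlinarith
        obtain ⟨p, hp⟩ := Nat.exists_eq_add_of_le h1
        obtain ⟨q, hq⟩ := Nat.exists_eq_add_of_le h2
        have hy : y = 19 * p + 60 * q := by omega
        have hz' : z = 6 * p + 19 * q := by omega
        refine ⟨(p, q), ?_, ?_, ?_⟩
        · subst hy hz'
          simp only
          nlinarith
        · simp only
          nlinarith
        · simp only [linStep, Prod.mk.injEq]
          omega) (y, z) h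
  exact ⟨n, hn⟩

theorem exists_iterate_of_sq_add_nine_eq_ten_mul_sq {y z : ℕ} (h : y ^ 2 + 9 = 10 * z ^ 2)
    (h3 : ¬ 3 ∣ z) :
    ∃ n s, (s = (1, 1) ∨ s = (41, 13)) ∧ (linStep 19 60 6 19)^[n] s = (y, z) := by
  refine exists_iterate_of_descent
    (P := fun v => v.1 ^ 2 + 9 = 10 * v.2 ^ 2 ∧ ¬ 3 ∣ v.2)
    (B := fun v => v = (1, 1) ∨ v = (41, 13)) (f := linStep 19 60 6 19) ?_ (y, z) ⟨h, h3⟩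
  rintro ⟨y, z⟩ ⟨h, h3⟩
  simp only at h h3
  rcases Nat.lt_or_ge z 19 with hz | hz
  · left
    have hy : y < 60 := by nlinarith
    interval_cases z <;> first | omega | (interval_cases y <;> simp at h ⊢)
  · right
    have h1 : 60 * z ≤ 19 * y := by nlinarith
    have h2 : 6 * y ≤ 19 * z := by nlinarith
    obtain ⟨p, hp⟩ := Nat.exists_eq_add_of_le h1
    obtain ⟨q, hq⟩ := Nat.exists_eq_add_of_le h2
    have hy : y = 19 * p + 60 * q := by omega
    have hz' : z = 6 * p + 19 * q := by omega
    refine ⟨(p, q), ⟨?_, ?_⟩, ?_, ?_⟩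
    · subst hy hz'
      simp only
      nlinarith
    · simp only
      omega
    · simp only
      nlinarith
    · simp only [linStep, Prod.mk.injEq]
      omega

theorem dvd_of_sq_add_mul_add_one {w z : ℕ} (h : w ^ 2 + z * w + 1 = z ^ 2) (h25 : 25 ∣ z) :
    3001 ∣ z := by
  obtain ⟨n, hn⟩ := exists_iterate_of_sq_add_mul_add_one h
  have := linStep_iterate_of_period (Q := 75025) (L := 50) (a := 1) (b := 1) (c := 1) (d := 2)
    (s := (0, 1)) (fun t => t % 25 = 0 → t % 3001 = 0) (by norm_num)
    (by decide +kernel) (by decide +kernel) n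
  rw [hn] at this
  simp only at this
  omega

theorem dvd_of_sq_add_one_eq_two_mul_sq {y z : ℕ} (h : y ^ 2 + 1 = 2 * z ^ 2) (h25 : 25 ∣ z) :
    29 ∣ z := by
  obtain ⟨n, hn⟩ := exists_iterate_of_sq_add_one_eq_two_mul_sq h
  have := linStep_iterate_of_period (Q := 725) (L := 30) (a := 3) (b := 4) (c := 2) (d := 3)
    (s := (1, 1)) (fun t => t % 25 = 0 → t % 29 = 0) (by norm_num)
    (by decide +kernel) (by decide +kernel) n
  rw [hn] at this
  simp only at this
  omega

theorem dvd_of_sq_add_one_eq_ten_mul_sq {y z : ℕ} (h : y ^ 2 + 1 = 10 * z ^ 2) (h5 : 5 ∣ z) :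
    281 ∣ z := by
  obtain ⟨n, hn⟩ := exists_iterate_of_sq_add_one_eq_ten_mul_sq h
  have := linStep_iterate_of_period (Q := 1405) (L := 10) (a := 19) (b := 60) (c := 6) (d := 19)
    (s := (3, 1)) (fun t => t % 5 = 0 → t % 281 = 0) (by norm_num)
    (by decide +kernel) (by decide +kernel) n
  rw [hn] at this
  simp only at this
  omega

theorem pow_mod_ne_one_of_sq_add_nine_eq_ten_mul_sq {y z : ℕ} (h : y ^ 2 + 9 = 10 * z ^ 2)
    (h3 : ¬ 3 ∣ z) (h125 : 125 ∣ z) : z ^ 250 % 3001 ≠ 1 := by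
  obtain ⟨n, s, hs, hn⟩ := exists_iterate_of_sq_add_nine_eq_ten_mul_sq h h3
  have key : z % 375125 % 125 = 0 → (z % 375125) ^ 250 % 3001 ≠ 1 := by
    rcases hs with rfl | rfl
    · have := linStep_iterate_of_period (Q := 375125) (L := 750) (a := 19) (b := 60) (c := 6)
        (d := 19) (s := (1, 1)) (fun t => t % 125 = 0 → t ^ 250 % 3001 ≠ 1) (by norm_num)
        (by decide +kernel) (by decide +kernel) n
      rwa [hn] at this
    · have := linStep_iterate_of_period (Q := 375125) (L := 750) (a := 19) (b := 60) (c := 6)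
        (d := 19) (s := (41, 13)) (fun t => t % 125 = 0 → t ^ 250 % 3001 ≠ 1) (by norm_num)
        (by decide +kernel) (by decide +kernel) n
      rwa [hn] at this
  have hmod : z % 375125 % 3001 = z % 3001 := Nat.mod_mod_of_dvd z (by norm_num)
  rw [Nat.pow_mod, hmod, ← Nat.pow_mod] at key
  exact key (by omega)

theorem not_dvd_five_pow {p : ℕ} (hp : p.Prime) (h5 : p ≠ 5) (j : ℕ) : ¬ p ∣ 5 ^ j :=
  fun h => h5 ((Nat.prime_dvd_prime_iff_eq hp Nat.prime_five).1 (hp.dvd_of_dvd_pow h))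

theorem three_dvd_of_sq_add_sq {x y : ℕ} (h : 3 ∣ x ^ 2 + y ^ 2) : 3 ∣ x := by
  have hx := Nat.pow_mod x 2 3
  have hy := Nat.pow_mod y 2 3
  have h1 : x % 3 = 0 ∨ x % 3 = 1 ∨ x % 3 = 2 := by omega
  have h2 : y % 3 = 0 ∨ y % 3 = 1 ∨ y % 3 = 2 := by omega
  rcases h1 with h1 | h1 | h1 <;> rcases h2 with h2 | h2 | h2 <;> rw [h1] at hx <;>
    rw [h2] at hy <;> omega

theorem not_sq_eq_of_between {y n k : ℕ} (h1 : k ^ 2 < n) (h2 : n < (k + 1) ^ 2) :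
    y ^ 2 ≠ n := by
  rintro rfl
  have a := lt_of_pow_lt_pow_left₀ 2 (by positivity) h1
  have b := lt_of_pow_lt_pow_left₀ 2 (by positivity) h2
  omega

/-- Powers of `5` that are sums of two squares, one of them at most `9`. -/
theorem eq_of_sq_add_sq_eq_five_pow {e y m : ℕ} (he : 1 ≤ e) (he3 : e ≤ 3) (hm : 2 ≤ m)
    (h : e ^ 2 + y ^ 2 = 5 ^ m) : m = 2 ∧ e = 3 ∨ m = 3 ∧ e = 2 := by
  obtain ⟨j, hj | hj⟩ := Nat.even_or_odd' m
  · subst hj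
    rw [mul_comm, pow_mul] at h
    have hlt : y < 5 ^ j := lt_of_pow_lt_pow_left₀ 2 (by positivity) (by nlinarith)
    have hle : 5 ^ j ≤ 5 := by nlinarith
    have hj1 : j = 1 := by
      have := (Nat.pow_le_pow_iff_right (a := 5) (n := j) (m := 1) (by norm_num)).1 (by simpa)
      omega
    subst hj1
    have : y < 5 := by simpa using hlt
    left
    interval_cases e <;> interval_cases y <;> simp at h ⊢
  · subst hj
    have h' : e ^ 2 + y ^ 2 = 5 * (5 ^ j) ^ 2 := by rw [h]; ring
    have hj1 : 1 ≤ j := by omega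
    rcases Nat.lt_or_ge j 2 with hj2 | hj2
    · obtain rfl : j = 1 := by omega
      interval_cases e
      · exact absurd (show y ^ 2 = 124 by omega)
          (not_sq_eq_of_between (k := 11) (by norm_num) (by norm_num))
      · right; simp
      · exact absurd (show y ^ 2 = 116 by omega)
          (not_sq_eq_of_between (k := 10) (by norm_num) (by norm_num))
    · exfalso
      have h25 : 25 ∣ 5 ^ j := pow_dvd_pow 5 hj2
      have hodd : 5 ^ j % 2 = 1 := by simp [Nat.pow_mod]
      have h3 := not_dvd_five_pow Nat.prime_three (by norm_num) j
      have h3001 := not_dvd_five_pow (p := 3001) (by norm_num) (by norm_num) j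
      generalize 5 ^ j = z at *
      have hyz : z ≤ y := by
        have : 25 ≤ z := Nat.le_of_dvd (by omega) h25
        by_contra! hc
        nlinarith
      obtain ⟨w, rfl⟩ := Nat.exists_eq_add_of_le hyz
      interval_cases e
      · have := dvd_of_sq_add_mul_add_one (w := w) (z := 2 * z) (by nlinarith) (by omega)
        omega
      · have hw : w % 2 = 0 := by
          by_contra hc
          have : (z + w) % 2 = 0 := by omega
          obtain ⟨t, ht⟩ := Nat.dvd_of_mod_eq_zero this
          obtain ⟨u, hu⟩ : ∃ u, z = 2 * u + 1 := ⟨z / 2, by omega⟩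
          rw [ht, hu] at h'
          ring_nf at h'
          omega
        obtain ⟨t, rfl⟩ := Nat.dvd_of_mod_eq_zero hw
        exact h3001 (dvd_of_sq_add_mul_add_one (w := t) (by nlinarith) h25)
      · refine h3 (three_dvd_of_sq_add_sq (y := z + w) ?_)
        exact ⟨2 * z ^ 2 - 3, by omega⟩

/-- Doubled powers of `5` that are sums of two squares, one of them at most `9`. -/
theorem eq_of_sq_add_sq_eq_two_mul_five_pow {e y m : ℕ} (he : 1 ≤ e) (he3 : e ≤ 3)
    (hm : 2 ≤ m) (h : e ^ 2 + y ^ 2 = 2 * 5 ^ m) : m = 2 ∧ e = 1 ∨ m = 5 ∧ e = 3 := by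
  have he2 : e ≠ 2 := by
    rintro rfl
    have : 5 ^ m % 2 = 1 := by simp [Nat.pow_mod]
    obtain ⟨t, rfl | rfl⟩ := Nat.even_or_odd' y <;> ring_nf at h <;> omega
  obtain ⟨j, hj | hj⟩ := Nat.even_or_odd' m
  · subst hj
    have h' : e ^ 2 + y ^ 2 = 2 * (5 ^ j) ^ 2 := by rw [h]; ring
    have h3 := not_dvd_five_pow Nat.prime_three (by norm_num) j
    interval_cases e
    · rcases Nat.lt_or_ge j 2 with hj2 | hj2
      · left; omega
      · exact absurd (dvd_of_sq_add_one_eq_two_mul_sq (y := y) (by omega) (pow_dvd_pow 5 hj2))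
          (not_dvd_five_pow (by norm_num) (by norm_num) j)
    · omega
    · refine absurd (three_dvd_of_sq_add_sq (y := y) ?_) h3
      exact ⟨(5 ^ j) ^ 2 - 3, by omega⟩
  · subst hj
    have h' : e ^ 2 + y ^ 2 = 10 * (5 ^ j) ^ 2 := by rw [h]; ring
    have hj1 : 1 ≤ j := by omega
    interval_cases e
    · exact absurd (dvd_of_sq_add_one_eq_ten_mul_sq (y := y) (by omega)
        (dvd_pow_self 5 (by omega))) (not_dvd_five_pow (by norm_num) (by norm_num) j)
    · omega
    · rcases Nat.lt_or_ge j 3 with hj3 | hj3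
      · interval_cases j
        · exact absurd (show y ^ 2 = 241 by omega)
            (not_sq_eq_of_between (k := 15) (by norm_num) (by norm_num))
        · right; simp
      · have h3 := not_dvd_five_pow Nat.prime_three (by norm_num) j
        refine absurd ?_ (pow_mod_ne_one_of_sq_add_nine_eq_ten_mul_sq (y := y) (by omega) h3
          (pow_dvd_pow 5 hj3))
        rw [← pow_mul, mul_comm, pow_mul, Nat.pow_mod]
        norm_num

/-- Extracting the power of `5` from a sum of two squares. -/
theorem exists_five_pow_mul_sq_add_sq (n : ℕ) (hn : 0 < n) (a b : ℤ)
    (h : a ^ 2 + b ^ 2 = n) :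
    ∃ (k : ℕ) (c d : ℤ), a ^ 2 + b ^ 2 = 5 ^ k * (c ^ 2 + d ^ 2) ∧ ¬ 5 ∣ c ^ 2 + d ^ 2 := by
  induction n using Nat.strong_induction_on generalizing a b with
  | _ n ih =>
    by_cases h5 : (5 : ℤ) ∣ a ^ 2 + b ^ 2
    · obtain ⟨p, q, hpq⟩ : ∃ p q : ℤ, a ^ 2 + b ^ 2 = 5 * (p ^ 2 + q ^ 2) := by
        have h1 : (5 : ℤ) ∣ (a - 2 * b) * (a + 2 * b) := by
          obtain ⟨t, ht⟩ := h5
          exact ⟨t - b ^ 2, by linear_combination ht⟩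
        rcases (Int.prime_iff_natAbs_prime.2 (by norm_num)).dvd_or_dvd h1 with ⟨t, ht⟩ | ⟨t, ht⟩
        · obtain rfl : a = 2 * b + 5 * t := by omega
          exact ⟨b + 2 * t, t, by ring⟩
        · obtain rfl : a = 5 * t - 2 * b := by omega
          exact ⟨b - 2 * t, t, by ring⟩
      obtain ⟨r, hr⟩ := Int.eq_ofNat_of_zero_le (show 0 ≤ p ^ 2 + q ^ 2 by positivity)
      obtain ⟨k, c, d, hk, hcd⟩ := ih r (by omega) (by omega) p q hr
      exact ⟨k + 1, c, d, by rw [hpq, hk]; ring, hcd⟩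
    · exact ⟨0, a, b, by ring, h5⟩

/-- The powers `(2 + i) ^ m`, `m ≥ 1`, recorded by coordinates with their residue modulo `5`. -/
theorem exists_two_add_I_pow (m : ℕ) :
    ∃ u v : ℤ, u ^ 2 + v ^ 2 = 5 ^ (m + 1) ∧ 5 ∣ u - 2 * v ∧ ¬ 5 ∣ v := by
  induction m with
  | zero => exact ⟨2, 1, by norm_num, by norm_num, by norm_num⟩
  | succ m ih =>
    obtain ⟨u, v, h, h1, h2⟩ := ih
    exact ⟨2 * u - v, u + 2 * v, by rw [pow_succ 5, ← h]; ring, by omega, by omega⟩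

theorem not_five_dvd_mul {x y : ℤ} (h : 5 ∣ x - 2 * y) (hy : ¬ 5 ∣ y) : ¬ 5 ∣ x * y := by
  intro hxy
  rcases (Int.prime_iff_natAbs_prime.2 (by norm_num)).dvd_or_dvd hxy with h' | h' <;> omega

/-- Multiplying by `u + v i` with `u ≡ 2 v` modulo `5`. -/
theorem not_five_dvd_mul_of_sq_add_sq {u v c d : ℤ} (h : 5 ∣ u - 2 * v) (hv : ¬ 5 ∣ v)
    (hcd : ¬ 5 ∣ c ^ 2 + d ^ 2) : ¬ 5 ∣ (c * u - d * v) * (c * v + d * u) := by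
  obtain ⟨t, ht⟩ := h
  obtain rfl : u = 2 * v + 5 * t := by omega
  refine not_five_dvd_mul ⟨c * t - d * v - 2 * d * t, by ring⟩ fun h5 => ?_
  have h6 : (5 : ℤ) ∣ v * (c + 2 * d) := by
    obtain ⟨s, hs⟩ := h5
    exact ⟨s - d * t, by linear_combination hs⟩
  rcases (Int.prime_iff_natAbs_prime.2 (by norm_num)).dvd_or_dvd h6 with h' | ⟨s, hs⟩
  · exact hv h'
  · obtain rfl : c = 5 * s - 2 * d := by omega
    exact hcd ⟨5 * s ^ 2 - 4 * s * d + d ^ 2, by ring⟩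

theorem sq_eq_of_small {R e y f z : ℤ} (hR : 75 ≤ R) (h1 : e ^ 2 + y ^ 2 = R)
    (h2 : f ^ 2 + z ^ 2 = R) (he : e ^ 2 < 10) (hf : f ^ 2 < 10) : e ^ 2 = f ^ 2 := by
  have key : ∀ {p q : ℤ}, 0 ≤ p → 66 ≤ p ^ 2 → p < q → q ^ 2 - p ^ 2 < 10 → False := by
    intro p q hp hp2 hpq h
    have : 5 ≤ p := by nlinarith
    nlinarith
  rw [← sq_abs y] at h1
  rw [← sq_abs z] at h2
  rcases lt_trichotomy |y| |z| with h | h | h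
  · exact (key (abs_nonneg y) (by linarith) h (by nlinarith [sq_nonneg f])).elim
  · rw [h] at h1
    linarith
  · exact (key (abs_nonneg z) (by linarith) h (by nlinarith [sq_nonneg e])).elim

theorem natAbs_le_three {u : ℤ} (h : u ^ 2 < 10) : u.natAbs ≤ 3 := by
  have h1 : u < 4 := by nlinarith
  have h2 : -4 < u := by nlinarith
  omega

theorem sq_lt_of_mul_sq_lt {c u : ℤ} (hc : c ≠ 0) (h : (c * u) ^ 2 < 10) : u ^ 2 < 10 := by
  have := sq_pos_of_ne_zero hc
  nlinarith [mul_pow c u 2, mul_nonneg (show 0 ≤ c ^ 2 - 1 by omega) (sq_nonneg u)]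

theorem five_pow_mul_sq_of_small {k : ℕ} {c u v : ℤ} (hc : c ≠ 0) (hu : u ≠ 0)
    (huv : u ^ 2 + v ^ 2 = 5 ^ (k + 2)) (hs : (c * u) ^ 2 < 10) :
    5 ^ k * c ^ 2 = 1 ∨ 5 ^ k * c ^ 2 = 5 := by
  have hu3 := natAbs_le_three (sq_lt_of_mul_sq_lt hc hs)
  have hcu : (c * u).natAbs ≤ 3 := natAbs_le_three hs
  rw [Int.natAbs_mul] at hcu
  have h := eq_of_sq_add_sq_eq_five_pow (e := u.natAbs) (y := v.natAbs) (m := k + 2)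
    (by omega) hu3 (by omega) (by zify; simpa using huv)
  have hc1 : c.natAbs = 1 := by
    have := Int.natAbs_pos.2 hc
    rcases h with ⟨-, h⟩ | ⟨-, h⟩ <;> rw [h] at hcu <;> omega
  have hc2 : c ^ 2 = 1 := by rw [← Int.natAbs_sq, hc1]; norm_num
  rw [hc2]
  rcases h with ⟨h, -⟩ | ⟨h, -⟩
  · obtain rfl : k = 0 := by omega
    simp
  · obtain rfl : k = 1 := by omega
    simp

theorem five_pow_mul_two_mul_sq_of_small {k : ℕ} {c u v : ℤ} (hc : c ≠ 0) (hu : u ≠ 0)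
    (huv : u ^ 2 + v ^ 2 = 2 * 5 ^ (k + 2)) (hs : (c * u) ^ 2 < 10) :
    5 ^ k * (2 * c ^ 2) ∈ ({2, 8, 18, 250} : Set ℤ) := by
  have hu3 := natAbs_le_three (sq_lt_of_mul_sq_lt hc hs)
  have hcu : (c * u).natAbs ≤ 3 := natAbs_le_three hs
  rw [Int.natAbs_mul] at hcu
  have h := eq_of_sq_add_sq_eq_two_mul_five_pow (e := u.natAbs) (y := v.natAbs) (m := k + 2)
    (by omega) hu3 (by omega) (by zify; simpa using huv)
  have hc0 := Int.natAbs_pos.2 hc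
  rw [← Int.natAbs_sq c]
  rcases h with ⟨hk, h⟩ | ⟨hk, h⟩
  · obtain rfl : k = 0 := by omega
    rw [h, mul_one] at hcu
    interval_cases c.natAbs <;> norm_num
  · obtain rfl : k = 3 := by omega
    rw [h] at hcu
    have hc1 : c.natAbs = 1 := by omega
    rw [hc1]
    norm_num

/-- For integers `a`, `b`, not both zero, with `a² + b² ∉ {1, 2, 5, 8, 18, 250}`, there
exist integers `x`, `y` with `(5a)² + (5b)² = x² + y²`, `x², y² ≥ 10`, `5 ∤ xy`. -/
theorem stmt_5 (a b : ℤ) (hab : ¬(a = 0 ∧ b = 0))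
    (hexc : a ^ 2 + b ^ 2 ∉ ({1, 2, 5, 8, 18, 250} : Set ℤ)) :
    ∃ x y : ℤ, (5 * a) ^ 2 + (5 * b) ^ 2 = x ^ 2 + y ^ 2 ∧
      10 ≤ x ^ 2 ∧ 10 ≤ y ^ 2 ∧ ¬(5 ∣ x * y) := by
  have hpos : 0 < a ^ 2 + b ^ 2 := by
    by_contra! hle
    exact hab ⟨by nlinarith, by nlinarith⟩
  have hR : 75 ≤ 25 * (a ^ 2 + b ^ 2) := by
    simp only [Set.mem_insert_iff, not_or] at hexc
    omega
  obtain ⟨n, hn⟩ := Int.eq_ofNat_of_zero_le hpos.le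
  obtain ⟨k, c, d, hN, hcd⟩ := exists_five_pow_mul_sq_add_sq n (by omega) a b hn
  obtain ⟨u, v, huv, hmod, hv⟩ := exists_two_add_I_pow (k + 1)
  have hu0 : u ≠ 0 := by rintro rfl; omega
  have hv0 : v ≠ 0 := by rintro rfl; omega
  have hsub : u - v ≠ 0 := by omega
  have hadd : u + v ≠ 0 := by omega
  by_contra! hno
  have hsmall : ∀ x y : ℤ, 25 * (a ^ 2 + b ^ 2) = x ^ 2 + y ^ 2 → ¬ 5 ∣ x * y →
      x ^ 2 < 10 ∨ y ^ 2 < 10 := by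
    intro x y h hxy
    by_contra! hc
    exact hxy (hno x y (by linear_combination h) hc.1 hc.2)
  have hnorm : ∀ d' : ℤ, d' ^ 2 = d ^ 2 →
      25 * (a ^ 2 + b ^ 2) = (c * u - d' * v) ^ 2 + (c * v + d' * u) ^ 2 := by
    intro d' hd'
    rw [hN, ← hd']
    linear_combination (-(c ^ 2 + d' ^ 2)) * huv
  have hn1 := hnorm d rfl
  have hn2 := hnorm (-d) (by ring)
  have h1 := hsmall _ _ hn1 (not_five_dvd_mul_of_sq_add_sq hmod hv hcd)
  have h2 := hsmall _ _ hn2 (not_five_dvd_mul_of_sq_add_sq hmod hv (by rwa [neg_sq]))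
  have hdeg : c * d = 0 ∨ c ^ 2 = d ^ 2 := by
    have hsame : (c * u - d * v) ^ 2 = (c * u - -d * v) ^ 2 ∨
        (c * u - d * v) ^ 2 = (c * v + -d * u) ^ 2 := by
      rcases h1 with h1 | h1 <;> rcases h2 with h2 | h2
      · exact .inl (sq_eq_of_small hR hn1.symm hn2.symm h1 h2)
      · exact .inr (sq_eq_of_small hR hn1.symm (by rw [add_comm]; exact hn2.symm) h1 h2)
      · have := sq_eq_of_small hR (by rw [add_comm]; exact hn1.symm) hn2.symm h1 h2
        exact .inr (by linarith)
      · have := sq_eq_of_small hR (by rw [add_comm]; exact hn1.symm)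
          (by rw [add_comm]; exact hn2.symm) h1 h2
        exact .inl (by linarith)
    rcases hsame with h | h
    · left
      have : c * d * (u * v) = 0 := by linarith
      exact (mul_eq_zero.1 this).resolve_right (mul_ne_zero hu0 hv0)
    · right
      have : (c ^ 2 - d ^ 2) * ((u - v) * (u + v)) = 0 := by linarith
      linarith [(mul_eq_zero.1 this).resolve_right (mul_ne_zero hsub hadd)]
  apply hexc
  have huv' : v ^ 2 + u ^ 2 = 5 ^ (k + 2) := by rw [add_comm]; exact huv
  have hdiag : (u - v) ^ 2 + (u + v) ^ 2 = 2 * 5 ^ (k + 2) := by linear_combination 2 * huv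
  have hdiag' : (u + v) ^ 2 + (u - v) ^ 2 = 2 * 5 ^ (k + 2) := by linear_combination 2 * huv
  have haxis : ∀ t : ℤ, a ^ 2 + b ^ 2 = 5 ^ k * t ^ 2 → (t * u) ^ 2 < 10 ∨ (t * v) ^ 2 < 10 →
      a ^ 2 + b ^ 2 ∈ ({1, 2, 5, 8, 18, 250} : Set ℤ) := by
    intro t ht h
    have ht0 : t ≠ 0 := by rintro rfl; simp [ht] at hpos
    have : 5 ^ k * t ^ 2 = 1 ∨ 5 ^ k * t ^ 2 = 5 := h.elim
      (five_pow_mul_sq_of_small ht0 hu0 huv) (five_pow_mul_sq_of_small ht0 hv0 huv')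
    rw [ht]
    rcases this with h | h <;> simp [h]
  rcases hdeg with h | h
  · rcases mul_eq_zero.1 h with rfl | rfl
    · exact haxis d (by rw [hN]; ring) (h1.symm.imp (fun h => by linarith) fun h => by linarith)
    · exact haxis c (by rw [hN]; ring) (h1.imp (fun h => by linarith) fun h => by linarith)
  · have hN' : a ^ 2 + b ^ 2 = 5 ^ k * (2 * c ^ 2) := by rw [hN, ← h]; ring
    have hc0 : c ≠ 0 := by rintro rfl; simp [hN'] at hpos
    have hs : (c * (u - v)) ^ 2 < 10 ∨ (c * (u + v)) ^ 2 < 10 := by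
      rcases sq_eq_sq_iff_eq_or_eq_neg.1 h.symm with rfl | rfl
      · exact h1.imp (fun h => by linarith) fun h => by linarith
      · exact h1.symm.imp (fun h => by linarith) fun h => by linarith
    have := hs.elim (five_pow_mul_two_mul_sq_of_small hc0 hsub hdiag)
      (five_pow_mul_two_mul_sq_of_small hc0 hadd hdiag')
    rw [← hN'] at this
    simp only [Set.mem_insert_iff, Set.mem_singleton_iff] at this ⊢
    omega
end

section
/- Every positive integer n with n ≡ 1 (mod 5) that can be written as a sum of three squares of integers can also be written as a sum of three nonunit squares, except for n = 1, 6, 11, 21, 26, 46, 51, and 91. That is, if n ≡ 1 (mod 5), n = a² + b² + c² for some integers a, b, c, and n ∉ {1, 6, 11, 21, 26, 46, 51, 91}, then there exist integers x, y, z with n = x² + y² + z² and x² ≠ 1, y² ≠ 1, z² ≠ 1. -/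
/-- `n` is a sum of three squares of integers, none of which is a unit. -/
def IsSumThreeNonunitSquares (n : ℤ) : Prop :=
  ∃ x y z : ℤ, n = x ^ 2 + y ^ 2 + z ^ 2 ∧ x ^ 2 ≠ 1 ∧ y ^ 2 ≠ 1 ∧ z ^ 2 ≠ 1

namespace IsSumThreeNonunitSquares

theorem of_ne {n : ℤ} (x y z : ℤ) (h : n = x ^ 2 + y ^ 2 + z ^ 2) (hx : x ≠ 1 ∧ x ≠ -1)
    (hy : y ≠ 1 ∧ y ≠ -1) (hz : z ≠ 1 ∧ z ≠ -1) : IsSumThreeNonunitSquares n :=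
  ⟨x, y, z, h, sq_ne_one_iff.2 hx, sq_ne_one_iff.2 hy, sq_ne_one_iff.2 hz⟩

/-- Rotate the plane of the first and third coordinates of `(1, b, c)` by the angle of `3 + 4i`. -/
theorem one_add {n b c : ℤ} (hn : n = 1 + b ^ 2 + c ^ 2) (hc : c % 5 = 2)
    (hc₁ : c ≠ 2) (hc₂ : c ≠ -3) (hb : b ≠ 1 ∧ b ≠ -1) : IsSumThreeNonunitSquares n := by
  obtain ⟨k, rfl⟩ : ∃ k, c = 5 * k + 2 := ⟨c / 5, by omega⟩
  exact of_ne (-1 - 4 * k) (2 + 3 * k) b (by rw [hn]; ring) (by omega) (by omega) hb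

theorem two_add_sq {n c : ℤ} (hn : n = 2 + c ^ 2) (hc : c % 5 = 2)
    (h : n ≠ 6 ∧ n ≠ 11 ∧ n ≠ 51) : IsSumThreeNonunitSquares n := by
  have key : ∀ t : ℤ, (c = 3 * t - 2 ∨ c = -(3 * t - 2)) → IsSumThreeNonunitSquares n := by
    intro t ht
    have ht' : n = 2 + (3 * t - 2) ^ 2 := by rcases ht with rfl | rfl <;> rw [hn]; ring
    have h₀ : t ≠ 0 := by rintro rfl; omega
    have h₁ : t ≠ 1 := by rintro rfl; omega
    have h₃ : t ≠ 3 := by rintro rfl; omega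
    exact of_ne (1 - 2 * t) (1 - 2 * t) (t - 2) (by rw [ht']; ring) (by omega) (by omega)
      (by omega)
  rcases (by omega : c % 3 = 0 ∨ c % 3 = 1 ∨ c % 3 = 2) with h3 | h3 | h3
  · obtain ⟨k, rfl⟩ : ∃ k, c = 15 * k - 3 := ⟨(c + 3) / 15, by omega⟩
    have h₀ : k ≠ 0 := by rintro rfl; omega
    by_cases h₁ : k = 1
    · exact of_ne 11 5 0 (by rw [hn, h₁]; norm_num) (by omega) (by omega) (by omega)
    exact of_ne (1 - 10 * k) (11 * k - 3) (2 * k - 1) (by rw [hn]; ring) (by omega) (by omega)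
      (by omega)
  · exact key ((c + 2) / 3) (by omega)
  · exact key ((-c + 2) / 3) (by omega)

theorem five_add_sq {n b : ℤ} (hn : n = 5 + b ^ 2) (h5 : n % 5 = 1)
    (h : n ≠ 6 ∧ n ≠ 21) : IsSumThreeNonunitSquares n := by
  have key : ∀ t : ℤ, (b = 3 * t + 1 ∨ b = -(3 * t + 1)) → IsSumThreeNonunitSquares n := by
    intro t ht
    have ht' : n = 5 + (3 * t + 1) ^ 2 := by rcases ht with rfl | rfl <;> rw [hn]; ring
    have h₀ : t ≠ 0 := by rintro rfl; omega
    have h₁ : t ≠ 1 := by rintro rfl; omega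
    have h₂ : t ≠ -2 := by rintro rfl; omega
    exact of_ne (1 - 2 * t) (-2 - 2 * t) (t + 1) (by rw [ht']; ring) (by omega) (by omega)
      (by omega)
  rcases (by omega : b % 3 = 0 ∨ b % 3 = 1 ∨ b % 3 = 2) with h3 | h3 | h3
  · obtain ⟨u, rfl⟩ : ∃ u, b = 3 * u := ⟨b / 3, by omega⟩
    have h₀ : u ≠ 0 := by rintro rfl; omega
    have h₁ : u ≠ 1 := by rintro rfl; omega
    have h₂ : u ≠ -1 := by rintro rfl; omega
    by_cases h₃ : u = 3
    · exact of_ne 5 6 5 (by rw [hn, h₃]; norm_num) (by omega) (by omega) (by omega)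
    exact of_ne (-1 - 2 * u) (-2 * u) (u - 2) (by rw [hn]; ring) (by omega) (by omega)
      (by omega)
  · exact key ((b - 1) / 3) (by omega)
  · exact key ((-b - 1) / 3) (by omega)

theorem ten_add_sq_of_not_dvd {n b : ℤ} (hn : n = 10 + b ^ 2) (h5 : n % 5 = 1) (h3 : ¬ 3 ∣ b)
    (h : n ≠ 11 ∧ n ≠ 26) : IsSumThreeNonunitSquares n := by
  have key : ∀ t : ℤ, (b = 3 * t - 1 ∨ b = -(3 * t - 1)) → IsSumThreeNonunitSquares n := by
    intro t ht
    have ht' : n = 10 + (3 * t - 1) ^ 2 := by rcases ht with rfl | rfl <;> rw [hn]; ring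
    have h₀ : t ≠ 0 := by rintro rfl; omega
    have h₁ : t ≠ 1 := by rintro rfl; omega
    have h₂ : t ≠ 2 := by rintro rfl; omega
    have h₃ : t ≠ -1 := by rintro rfl; omega
    by_cases h₄ : t = 4
    · exact of_ne 5 9 5 (by rw [ht', h₄]; norm_num) (by omega) (by omega) (by omega)
    exact of_ne (-1 - 2 * t) (1 - 2 * t) (t - 3) (by rw [ht']; ring) (by omega) (by omega)
      (by omega)
  rcases (by omega : b % 3 = 1 ∨ b % 3 = 2) with h3 | h3
  · exact key ((-b + 1) / 3) (by omega)
  · exact key ((b + 1) / 3) (by omega)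

/-- Reflect `(1, 3q, 6q)` in `(2, 3, -7)`, which is possible when `q ≡ 1 [ZMOD 31]`. The powers of
five with `q ≢ 1 [ZMOD 31]` are excluded by the hypothesis modulo 7 and 31. -/
theorem one_add_mul_sq_of_sq_add_one_eq_five {n u : ℤ} {k : ℕ}
    (hu : u ^ 2 + 1 = 5 * (5 ^ k) ^ 2) (hn : n = 1 + 45 * (5 ^ k) ^ 2) (h : n ≠ 46) :
    IsSumThreeNonunitSquares n := by
  have h7 : (u : ZMod 7) ^ 2 + 1 = 5 * (5 ^ k) ^ 2 := by exact_mod_cast congrArg (Int.cast) hu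
  have h31 : (u : ZMod 31) ^ 2 + 1 = 5 * (5 ^ k) ^ 2 := by exact_mod_cast congrArg (Int.cast) hu
  have hk : k = 3 * (k / 3) + k % 3 := by omega
  have hq : ((5 ^ k : ℤ) : ZMod 31) = 1 := by
    push_cast
    rcases (by omega : k % 3 = 0 ∨ k % 3 = 1 ∨ k % 3 = 2) with h3 | h3 | h3
    · rw [hk, h3, pow_add, pow_mul, show (5 ^ 3 : ZMod 31) = 1 by decide]; simp
    · rw [hk, h3, ← pow_mul, mul_comm _ 2, pow_mul, pow_add, pow_mul,
        show ((5 ^ 2) ^ 3 : ZMod 7) = 1 by decide] at h7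
      generalize (u : ZMod 7) = v at h7
      simp only [one_pow] at h7
      exfalso; revert v; decide
    · rw [hk, h3, pow_add, pow_mul, show (5 ^ 3 : ZMod 31) = 1 by decide] at h31
      generalize (u : ZMod 31) = v at h31
      simp only [one_pow] at h31
      exfalso; revert v; decide
  generalize (5 ^ k : ℤ) = q at *
  obtain ⟨s, rfl⟩ : ∃ s, q = 31 * s + 1 := by
    have := (ZMod.intCast_eq_intCast_iff_dvd_sub 1 q 31).1 (by simpa using hq.symm)
    obtain ⟨s, hs⟩ := this
    exact ⟨s, by push_cast at hs; omega⟩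
  have h₀ : s ≠ 0 := by rintro rfl; omega
  exact of_ne (3 + 66 * s) (6 + 192 * s) (-1 - 45 * s) (by rw [hn]; ring) (by omega) (by omega)
    (by omega)

/-- Reflect `(1, 3q, 3q)` in a vector of norm 14. -/
theorem one_add_mul_sq_of_sq_add_one_eq_two {n u : ℤ} {k : ℕ}
    (hu : u ^ 2 + 1 = 2 * (5 ^ k) ^ 2) (hn : n = 1 + 18 * (5 ^ k) ^ 2) (h : n ≠ 19) :
    IsSumThreeNonunitSquares n := by
  have h7 : (u : ZMod 7) ^ 2 + 1 = 2 * ((5 ^ k : ℤ) : ZMod 7) ^ 2 := by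
    exact_mod_cast congrArg (Int.cast) hu
  have h0 : ((5 ^ k : ℤ) : ZMod 7) ≠ 0 := by
    push_cast
    have h5 : (5 : ZMod 7) ≠ 0 := by decide
    have : Fact (Nat.Prime 7) := ⟨by norm_num⟩
    exact pow_ne_zero _ h5
  generalize (5 ^ k : ℤ) = q at *
  have hq : (q : ZMod 7) = 1 ∨ (q : ZMod 7) = -1 ∨ (q : ZMod 7) = 2 ∨ (q : ZMod 7) = -2 := by
    generalize (u : ZMod 7) = v at h7
    generalize (q : ZMod 7) = w at *
    revert v w; decide
  have cast_iff : ∀ a : ℤ, (q : ZMod 7) = (a : ℤ) → ∃ s, q = 7 * s + a := fun a ha => by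
    obtain ⟨s, hs⟩ := (ZMod.intCast_eq_intCast_iff_dvd_sub a q 7).1 ha.symm
    exact ⟨s, by push_cast at hs; omega⟩
  have key₁ : ∀ s : ℤ, n = 1 + 18 * (7 * s + 1) ^ 2 → IsSumThreeNonunitSquares n := by
    intro s hs
    have h₀ : s ≠ 0 := by rintro rfl; omega
    exact of_ne (3 + 15 * s) (-3 - 24 * s) (-1 - 9 * s) (by rw [hs]; ring) (by omega) (by omega)
      (by omega)
  have key₂ : ∀ s : ℤ, n = 1 + 18 * (7 * s - 2) ^ 2 → IsSumThreeNonunitSquares n := fun s hs =>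
    of_ne (3 * s) (12 * s - 3) (27 * s - 8) (by rw [hs]; ring) (by omega) (by omega) (by omega)
  rcases hq with hq | hq | hq | hq
  · obtain ⟨s, rfl⟩ := cast_iff 1 (by simpa using hq)
    exact key₁ s hn
  · obtain ⟨s, rfl⟩ := cast_iff (-1) (by simpa using hq)
    exact key₁ (-s) (by rw [hn]; ring)
  · obtain ⟨s, rfl⟩ := cast_iff 2 (by simpa using hq)
    exact key₂ (-s) (by rw [hn]; ring)
  · obtain ⟨s, rfl⟩ := cast_iff (-2) (by simpa using hq)
    exact key₂ s (by rw [hn]; ring)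

/-- Reflect `(1, 3q, 9q)` in `(1, 3, -4)`. -/
theorem one_add_mul_sq_of_sq_add_one_eq_ten {n u : ℤ} {k : ℕ}
    (hu : u ^ 2 + 1 = 10 * (5 ^ k) ^ 2) (hn : n = 1 + 90 * (5 ^ k) ^ 2) (h : n ≠ 91) :
    IsSumThreeNonunitSquares n := by
  have h13 : (u : ZMod 13) ^ 2 + 1 = 10 * ((5 ^ k : ℤ) : ZMod 13) ^ 2 := by
    exact_mod_cast congrArg (Int.cast) hu
  have h4 : ((5 ^ k : ℤ) : ZMod 13) ^ 4 = 1 := by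
    push_cast
    rw [← pow_mul, mul_comm, pow_mul, show (5 ^ 4 : ZMod 13) = 1 by decide, one_pow]
  generalize (5 ^ k : ℤ) = q at *
  have hq : (q : ZMod 13) = 1 ∨ (q : ZMod 13) = -1 := by
    generalize (u : ZMod 13) = v at h13
    generalize (q : ZMod 13) = w at *
    revert v w; decide
  have cast_iff : ∀ a : ℤ, (q : ZMod 13) = (a : ℤ) → ∃ s, q = 13 * s + a := fun a ha => by
    obtain ⟨s, hs⟩ := (ZMod.intCast_eq_intCast_iff_dvd_sub a q 13).1 ha.symm
    exact ⟨s, by push_cast at hs; omega⟩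
  have key : ∀ s : ℤ, n = 1 + 90 * (13 * s + 1) ^ 2 → IsSumThreeNonunitSquares n := by
    intro s hs
    have h₀ : s ≠ 0 := by rintro rfl; omega
    exact of_ne (3 + 27 * s) (9 + 120 * s) (1 + 9 * s) (by rw [hs]; ring) (by omega) (by omega)
      (by omega)
  rcases hq with hq | hq
  · obtain ⟨s, rfl⟩ := cast_iff 1 (by simpa using hq)
    exact key s hn
  · obtain ⟨s, rfl⟩ := cast_iff (-1) (by simpa using hq)
    exact key (-s) (by rw [hn]; ring)

end IsSumThreeNonunitSquares

/-- Changing signs and swapping, a sum of two squares that is divisible by five, but not in a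
trivial way, has a summand whose root is `2` modulo five. -/
theorem exists_arrangement {x y : ℤ} (hx : ¬ 5 ∣ x) (hy : ¬ 5 ∣ y) (h : 5 ∣ x ^ 2 + y ^ 2) :
    ∃ b c : ℤ, b ^ 2 + c ^ 2 = x ^ 2 + y ^ 2 ∧ c % 5 = 2 ∧ ¬ 5 ∣ b ∧
      (((b = x ∨ b = -x) ∧ (c = y ∨ c = -y)) ∨ ((b = y ∨ b = -y) ∧ (c = x ∨ c = -x))) := by
  have hsq : ∀ t : ℤ, (t % 5 = 1 ∨ t % 5 = 4) → t ^ 2 % 5 = 1 := fun t ht => by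
    rcases ht with ht | ht <;> simp [pow_two, Int.mul_emod, ht]
  rcases (by omega : y % 5 = 2 ∨ y % 5 = 3 ∨ y % 5 = 1 ∨ y % 5 = 4) with h' | h' | h' | h'
  · exact ⟨x, y, rfl, h', hx, by simp⟩
  · exact ⟨x, -y, by ring, by omega, hx, by simp⟩
  all_goals
    have hy1 := hsq y (by omega)
    by_cases hx2 : x % 5 = 2
    · exact ⟨y, x, by ring, hx2, hy, by simp⟩
    by_cases hx3 : x % 5 = 3
    · exact ⟨y, -x, by ring, by omega, hy, by simp⟩
    have hx1 := hsq x (by omega)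
    omega

theorem exists_not_dvd_sq_add_sq (b c : ℤ) (h0 : b ^ 2 + c ^ 2 ≠ 0) (h5 : 5 ∣ b ^ 2 + c ^ 2) :
    ∃ x y : ℤ, ¬ 5 ∣ x ∧ ¬ 5 ∣ y ∧ x ^ 2 + y ^ 2 = b ^ 2 + c ^ 2 := by
  have hp : Prime (5 : ℤ) := by norm_num
  induction hN : (b ^ 2 + c ^ 2).natAbs using Nat.strong_induction_on generalizing b c with
  | _ N ih =>
  have hdvd : 5 ∣ b ↔ 5 ∣ c := by
    rw [← hp.dvd_pow_iff_dvd two_ne_zero, ← hp.dvd_pow_iff_dvd (a := c) two_ne_zero]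
    omega
  by_cases hb : 5 ∣ b
  · obtain ⟨c, rfl⟩ := hdvd.1 hb
    obtain ⟨b, rfl⟩ := hb
    have hscale : (5 * b) ^ 2 + (5 * c) ^ 2 = 25 * (b ^ 2 + c ^ 2) := by ring
    have rotate : ∀ x y : ℤ, ¬ 5 ∣ x - 2 * y → x ^ 2 + y ^ 2 = b ^ 2 + c ^ 2 →
        ∃ x y : ℤ, ¬ 5 ∣ x ∧ ¬ 5 ∣ y ∧ x ^ 2 + y ^ 2 = (5 * b) ^ 2 + (5 * c) ^ 2 :=
      fun x y hxy h => ⟨3 * x + 4 * y, 4 * x - 3 * y, by omega, by omega, by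
        rw [hscale, ← h]; ring⟩
    by_cases h : 5 ∣ b ^ 2 + c ^ 2
    · obtain ⟨x, y, hx, hy, hxy⟩ := ih _ (by omega) b c (by omega) h rfl
      by_cases h' : 5 ∣ x - 2 * y
      · exact rotate x (-y) (by omega) (by rw [← hxy]; ring)
      · exact rotate x y h' hxy
    · refine rotate b c (fun ⟨e, he⟩ => h ?_) rfl
      exact ⟨c ^ 2 + 4 * c * e + 5 * e ^ 2, by rw [show b = 2 * c + 5 * e by omega]; ring⟩
  · exact ⟨b, c, hb, fun hc => hb (hdvd.2 hc), rfl⟩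

/-- Split off the power of `2 + i` from the Gaussian integer `p + q i`. -/
theorem exists_pow_five_mul (p q : ℤ) (h : ¬ 5 ∣ p + 2 * q) :
    ∃ (j : ℕ) (a b c d : ℤ), p = c * a - d * b ∧ q = c * b + d * a ∧ c ^ 2 + d ^ 2 = 5 ^ j ∧
      ¬ 5 ∣ a ^ 2 + b ^ 2 ∧ ¬ 5 ∣ c + 2 * d ∧ (j = 0 ∨ 5 ∣ c - 2 * d) := by
  have hp : Prime (5 : ℤ) := by norm_num
  induction hN : (p ^ 2 + q ^ 2).natAbs using Nat.strong_induction_on generalizing p q with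
  | _ N ih =>
  by_cases hpq : 5 ∣ p - 2 * q
  · obtain ⟨t, ht⟩ := hpq
    obtain rfl : p = 5 * t + 2 * q := by omega
    have hscale : (5 * t + 2 * q) ^ 2 + q ^ 2 = 5 * ((2 * t + q) ^ 2 + (-t) ^ 2) := by ring
    have hpos : 0 < (5 * t + 2 * q) ^ 2 + q ^ 2 := by
      have : q ≠ 0 := by omega
      positivity
    obtain ⟨j, a, b, c, d, h₁, h₂, h₃, h₄, h₅, -⟩ :=
      ih _ (by omega) (2 * t + q) (-t) (by omega) rfl
    exact ⟨j + 1, a, b, 2 * c - d, c + 2 * d, by linear_combination 2 * h₁ - h₂,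
      by linear_combination h₁ + 2 * h₂, by rw [pow_succ 5, ← h₃]; ring, h₄, by omega,
      Or.inr (by omega)⟩
  · refine ⟨0, p, q, 1, 0, by ring, by ring, by norm_num, fun h' => ?_, by norm_num, Or.inl rfl⟩
    have : 5 ∣ (p + 2 * q) * (p - 2 * q) := by
      rw [show (p + 2 * q) * (p - 2 * q) = p ^ 2 + q ^ 2 - 5 * q ^ 2 by ring]
      exact dvd_sub h' (dvd_mul_right _ _)
    exact (hp.dvd_or_dvd this).elim h hpq

/-- If `u ^ 2 + 1` is divisible by five, it has another representation as a sum of two squares that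
are prime to five, unless it is a power of five or twice such a power. -/
theorem exists_sq_add_sq_eq_sq_add_one {u : ℤ} (hu : u % 5 = 2) :
    (∃ x y : ℤ, x ^ 2 + y ^ 2 = u ^ 2 + 1 ∧ ¬ 5 ∣ x ∧ ¬ 5 ∣ y ∧ (x ≠ 1 ∧ x ≠ -1) ∧
      (y ≠ 1 ∧ y ≠ -1)) ∨ ∃ j : ℕ, u ^ 2 + 1 = 5 ^ j ∨ u ^ 2 + 1 = 2 * 5 ^ j := by
  have hp : Prime (5 : ℤ) := by norm_num
  obtain ⟨j, a, b, c, d, h₁, h₂, h₃, h₄, h₅, h₆⟩ := exists_pow_five_mul u 1 (by omega)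
  have hnorm : u ^ 2 + 1 = 5 ^ j * (a ^ 2 + b ^ 2) := by
    rw [← h₃]; linear_combination (u + c * a - d * b) * h₁ + (1 + c * b + d * a) * h₂
  obtain ⟨e, he⟩ : 5 ∣ c - 2 * d := by
    refine h₆.resolve_left fun hj => h₄ ?_
    rw [hj, pow_zero, one_mul] at hnorm
    rw [← hnorm]
    obtain ⟨v, rfl⟩ : ∃ v, u = 5 * v + 2 := ⟨u / 5, by omega⟩
    exact ⟨5 * v ^ 2 + 4 * v + 1, by ring⟩
  have hd : ¬ 5 ∣ d := by omega
  have hc : ¬ 5 ∣ c := by omega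
  by_cases hone : a ^ 2 + b ^ 2 = 1
  · exact Or.inr ⟨j, Or.inl (by rw [hnorm, hone, mul_one])⟩
  by_cases htwo : a ^ 2 + b ^ 2 = 2
  · exact Or.inr ⟨j, Or.inr (by rw [hnorm, htwo, mul_comm])⟩
  have unit : ∀ s t : ℤ, s * t = 1 → t ^ 2 = 1 := fun s t h => by
    rcases Int.mul_eq_one_iff_eq_one_or_neg_one.1 h with ⟨-, rfl⟩ | ⟨-, rfl⟩ <;> norm_num
  refine Or.inl ⟨c * a + d * b, d * a - c * b, ?_, ?_, ?_, ⟨?_, ?_⟩, ⟨?_, ?_⟩⟩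
  · rw [hnorm, ← h₃]; ring
  · intro h
    have : 5 ∣ d * (2 * a + b) := by
      rw [show d * (2 * a + b) = c * a + d * b - 5 * (e * a) by linear_combination -a * he]
      exact dvd_sub h (dvd_mul_right _ _)
    obtain ⟨f, hf⟩ := (hp.dvd_or_dvd this).resolve_left hd
    exact h₄ ⟨a ^ 2 - 4 * a * f + 5 * f ^ 2, by rw [show b = 5 * f - 2 * a by omega]; ring⟩
  · intro h
    have : 5 ∣ d * (a - 2 * b) := by
      rw [show d * (a - 2 * b) = d * a - c * b + 5 * (e * b) by linear_combination b * he]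
      exact dvd_add h (dvd_mul_right _ _)
    obtain ⟨f, hf⟩ := (hp.dvd_or_dvd this).resolve_left hd
    exact h₄ ⟨b ^ 2 + 4 * b * f + 5 * f ^ 2, by rw [show a = 2 * b + 5 * f by omega]; ring⟩
  · intro h
    have : (c - d) * (a - b) = 0 := by linear_combination h + h₂
    obtain rfl : a = b := by rcases mul_eq_zero.1 this with h | h <;> omega
    have := unit (c + d) a (by linear_combination -h₂)
    omega
  · intro h
    have : (c + d) * (a + b) = 0 := by linear_combination h - h₂
    obtain rfl : b = -a := by rcases mul_eq_zero.1 this with h | h <;> omega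
    have := unit (d - c) a (by linear_combination -h₂)
    rw [neg_sq] at htwo
    omega
  · intro h
    have : c * b = 0 := by linarith
    have hb : b = 0 := (mul_eq_zero.1 this).resolve_left (by omega)
    have := unit d a (by linarith)
    rw [hb] at hone
    omega
  · intro h
    have : d * a = 0 := by linarith
    have ha : a = 0 := (mul_eq_zero.1 this).resolve_left (by omega)
    have := unit c b (by linarith)
    rw [ha] at hone
    omega

namespace IsSumThreeNonunitSquares

theorem ten_add_nine_mul_sq {n u : ℤ} (hn : n = 10 + 9 * u ^ 2) (hu : u % 5 = 2)
    (h : n ≠ 46 ∧ n ≠ 91) : IsSumThreeNonunitSquares n := by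
  obtain ⟨x, y, hxy, hx, hy, hx₁, hy₁⟩ | ⟨j, hj⟩ := exists_sq_add_sq_eq_sq_add_one hu
  · have hdvd : 5 ∣ x ^ 2 + y ^ 2 := by
      rw [hxy]
      obtain ⟨v, rfl⟩ : ∃ v, u = 5 * v + 2 := ⟨u / 5, by omega⟩
      exact ⟨5 * v ^ 2 + 4 * v + 1, by ring⟩
    obtain ⟨b, c, hbc, hc, hb, hcase⟩ := exists_arrangement (x := 3 * x) (y := 3 * y)
      (by omega) (by omega) (by rw [show (3 * x) ^ 2 + (3 * y) ^ 2 = (x ^ 2 + y ^ 2) * 9 by ring]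
                                exact Dvd.dvd.mul_right hdvd 9)
    exact one_add (b := b) (c := c) (by linear_combination hn - hbc - 9 * hxy) hc (by omega)
      (by omega) (by omega)
  · rcases Nat.even_or_odd' j with ⟨k, rfl | rfl⟩ <;> rcases hj with hj | hj
    · have hfac : (5 ^ k - u) * (5 ^ k + u) = 1 := by
        rw [mul_comm 2 k, pow_mul] at hj; linear_combination -hj
      rcases Int.mul_eq_one_iff_eq_one_or_neg_one.1 hfac with ⟨h₁, h₂⟩ | ⟨h₁, h₂⟩ <;> omega
    · rw [mul_comm 2 k, pow_mul] at hj
      refine one_add_mul_sq_of_sq_add_one_eq_two hj (by linear_combination hn + 9 * hj)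
        fun h19 => ?_
      rcases sq_eq_one_iff.1 (by omega : u ^ 2 = 1) with rfl | rfl <;> omega
    · rw [pow_succ 5, mul_comm 2 k, pow_mul, mul_comm] at hj
      exact one_add_mul_sq_of_sq_add_one_eq_five hj (by linear_combination hn + 9 * hj) h.1
    · rw [pow_succ 5, mul_comm 2 k, pow_mul] at hj
      exact one_add_mul_sq_of_sq_add_one_eq_ten (k := k) (u := u) (by linear_combination hj)
        (by linear_combination hn + 9 * hj) h.2

theorem ten_add_sq {n b : ℤ} (hn : n = 10 + b ^ 2) (h5 : n % 5 = 1)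
    (h : n ≠ 11 ∧ n ≠ 26 ∧ n ≠ 46 ∧ n ≠ 91) : IsSumThreeNonunitSquares n := by
  by_cases h3 : 3 ∣ b
  · obtain ⟨u, rfl⟩ := h3
    have hn' : n = 10 + 9 * u ^ 2 := by rw [hn]; ring
    have hmod : u % 5 = 2 ∨ u % 5 = 3 := by
      have hsq : u ^ 2 % 5 = 4 := by omega
      rcases (by omega : u % 5 = 0 ∨ u % 5 = 1 ∨ u % 5 = 2 ∨ u % 5 = 3 ∨ u % 5 = 4)
        with h | h | h | h | h <;> simp [pow_two, Int.mul_emod, h] at hsq ⊢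
    rcases hmod with hmod | hmod
    · exact ten_add_nine_mul_sq hn' hmod h.2.2
    · exact ten_add_nine_mul_sq (u := -u) (by rw [hn', neg_sq]) (by omega) h.2.2
  · exact ten_add_sq_of_not_dvd hn h5 h3 ⟨h.1, h.2.1⟩

theorem one_add_sq_add_sq {n x y : ℤ} (hn : n = 1 + x ^ 2 + y ^ 2) (h5 : n % 5 = 1)
    (h : n ≠ 1 ∧ n ≠ 6 ∧ n ≠ 11 ∧ n ≠ 21 ∧ n ≠ 26 ∧ n ≠ 46 ∧ n ≠ 51 ∧ n ≠ 91) :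
    IsSumThreeNonunitSquares n := by
  obtain ⟨x', y', hx, hy, hxy⟩ := exists_not_dvd_sq_add_sq x y (by omega) (by omega)
  obtain ⟨b, c, hbc, hc, -, -⟩ := exists_arrangement hx hy (by omega)
  have hn' : n = 1 + b ^ 2 + c ^ 2 := by omega
  by_cases hc₁ : c = 2
  · exact five_add_sq (b := b) (by rw [hn', hc₁]; ring) h5 (by omega)
  by_cases hc₂ : c = -3
  · exact ten_add_sq (b := b) (by rw [hn', hc₂]; ring) h5 (by omega)
  by_cases hb : b ^ 2 = 1
  · exact two_add_sq (by rw [hn', hb]; ring) hc (by omega)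
  · exact one_add hn' hc hc₁ hc₂ (sq_ne_one_iff.1 hb)

end IsSumThreeNonunitSquares


/-- Any `n ∈ 𝒮₃` with `n ≡ 1 (mod 5)` is a sum of three nonunit squares,
except `1, 6, 11, 21, 26, 46, 51, 91`. -/
theorem stmt_6 (n : ℕ) (hn : 0 < n) (h5 : n % 5 = 1)
    (hS3 : ∃ a b c : ℤ, (n : ℤ) = a ^ 2 + b ^ 2 + c ^ 2)
    (hexc : n ∉ ({1, 6, 11, 21, 26, 46, 51, 91} : Set ℕ)) :
    ∃ x y z : ℤ, (n : ℤ) = x ^ 2 + y ^ 2 + z ^ 2 ∧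
      x ^ 2 ≠ 1 ∧ y ^ 2 ≠ 1 ∧ z ^ 2 ≠ 1 := by
  simp only [Set.mem_insert_iff, Set.mem_singleton_iff, not_or] at hexc
  obtain ⟨a, b, c, habc⟩ := hS3
  have key : ∀ x y : ℤ, (n : ℤ) = 1 + x ^ 2 + y ^ 2 → IsSumThreeNonunitSquares n :=
    fun x y h => .one_add_sq_add_sq h (by omega) (by omega)
  by_cases ha : a ^ 2 = 1
  · exact key b c (by omega)
  by_cases hb : b ^ 2 = 1
  · exact key a c (by omega)
  by_cases hc : c ^ 2 = 1
  · exact key a b (by omega)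
  exact ⟨a, b, c, habc, ha, hb, hc⟩
end
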